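/- arXiv:2507.06789 — 8 statements merged into one kernel-verified Lean document; each statement's English description precedes it below -/
import Mathlib

section
/- For every real p ≥ 2, the optimal Khintchine constant C_p = √(2 π^{−1/p}) · Γ((p+1)/2)^{1/p} satisfies C_p ≤ √(p/2), where Γ is the Gamma function Γ(s) = ∫_0^∞ t^{s−1} e^{−t} dt. Moreover equality holds when p = 2. -/
open Real in
theorem log_Gamma_three_halves : log (Gamma (3 / 2)) = log π / 2 - log 2 := by
  have h : Gamma (3 / 2) = √π / 2 := by
    rw [show (3 / 2 : ℝ) = 1 / 2 + 1 by norm_num, Gamma_add_one (by norm_num), Gamma_one_half_eq]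
    ring
  rw [h, log_div (by positivity) (by norm_num), log_sqrt pi_pos.le]

open Real in
theorem log_Gamma_five_halves : log (Gamma (5 / 2)) = log π / 2 + log 3 - 2 * log 2 := by
  rw [show (5 / 2 : ℝ) = 3 / 2 + 1 by norm_num, Gamma_add_one (by norm_num),
    log_mul (by norm_num) (Gamma_pos_of_pos (by norm_num)).ne', log_Gamma_three_halves,
    log_div (by norm_num) (by norm_num)]
  ring

open Real in
/-- The tangent line of `x ↦ x * log x` at `a` lies below its graph. -/
theorem mul_log_add_sub_le_mul_log {a x : ℝ} (ha : 0 < a) (hx : 0 < x) :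
    x * log a + x - a ≤ x * log x := by
  have h := mul_le_mul_of_nonneg_left (one_sub_inv_le_log_of_pos (div_pos hx ha)) hx.le
  rw [log_div hx.ne' ha.ne', inv_div, mul_sub, mul_div_cancel₀ _ hx.ne'] at h
  linarith

open Real in
theorem Gamma_add_half_le_of_le_two {x : ℝ} (h1 : 1 ≤ x) (h2 : x ≤ 2) :
    Gamma (x + 1 / 2) ≤ √π * (x / 2) ^ x := by
  have hx : 0 < x := by linarith
  have hG : 0 < Gamma (x + 1 / 2) := Gamma_pos_of_pos (by linarith)
  rw [← log_le_log_iff hG (by positivity), log_mul (by positivity) (by positivity),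
    log_sqrt pi_pos.le, log_rpow (by positivity), log_div hx.ne' (by norm_num)]
  rcases le_total x (3 / 2) with h | h
  · have hc := convexOn_log_Gamma.2 (show (3 / 2 : ℝ) ∈ Set.Ioi 0 by norm_num)
      (show (2 : ℝ) ∈ Set.Ioi 0 by norm_num) (show 0 ≤ 3 - 2 * x by linarith)
      (show 0 ≤ 2 * x - 2 by linarith) (by ring)
    simp only [Function.comp_apply, smul_eq_mul, log_Gamma_three_halves, Gamma_two, log_one] at hc
    rw [show (3 - 2 * x) * (3 / 2) + (2 * x - 2) * 2 = x + 1 / 2 by ring] at hc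
    have ht := mul_log_add_sub_le_mul_log one_pos hx
    rw [log_one] at ht
    have he : 3 * log 2 - log π ≤ 1 := by
      rw [← log_rpow two_pos, ← log_div (by norm_num) pi_ne_zero,
        log_le_iff_le_exp (by positivity), div_le_iff₀ pi_pos]
      norm_num
      nlinarith [exp_one_gt_d9, pi_gt_three]
    nlinarith [mul_le_mul_of_nonneg_left he (sub_nonneg.2 h1)]
  · have hc := convexOn_log_Gamma.2 (show (3 / 2 : ℝ) ∈ Set.Ioi 0 by norm_num)
      (show (5 / 2 : ℝ) ∈ Set.Ioi 0 by norm_num) (show 0 ≤ 2 - x by linarith)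
      (show 0 ≤ x - 1 by linarith) (by ring)
    simp only [Function.comp_apply, smul_eq_mul, log_Gamma_three_halves,
      log_Gamma_five_halves] at hc
    rw [show (2 - x) * (3 / 2) + (x - 1) * (5 / 2) = x + 1 / 2 by ring] at hc
    have ht := mul_log_add_sub_le_mul_log (a := 3 / 2) (by norm_num) hx
    rw [log_div (by norm_num) (by norm_num)] at ht
    have hl : log 2 < 1 := log_two_lt_d9.trans (by norm_num)
    have h8 : 3 * log 2 ≤ 2 * log 3 := by
      rw [← log_rpow two_pos, ← log_rpow three_pos]
      exact log_le_log (by norm_num) (by norm_num)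
    nlinarith [mul_le_mul_of_nonneg_left hl.le (sub_nonneg.2 h)]

open Real in
theorem add_half_mul_rpow_self_le {y : ℝ} (hy : 1 ≤ y) :
    (y + 1 / 2) * (y / 2) ^ y ≤ ((y + 1) / 2) ^ (y + 1) := by
  have hy0 : 0 < y := by linarith
  have hb := one_add_mul_self_le_rpow_one_add (s := 1 / y)
    (by have : 0 < 1 / y := by positivity
        linarith) hy
  rw [mul_one_div_cancel hy0.ne'] at hb
  have hs : (y + 1) / 2 = (1 + 1 / y) * (y / 2) := by field_simp
  have hp : 0 < (y / 2) ^ y := by positivity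
  rw [rpow_add_one (by positivity)]
  nth_rw 1 [hs]
  rw [mul_rpow (by positivity) (by positivity)]
  have := mul_le_mul_of_nonneg_right hb hp.le
  nlinarith [mul_le_mul_of_nonneg_right this (by linarith : (0 : ℝ) ≤ (y + 1) / 2)]

open Real in
theorem Gamma_add_half_le {x : ℝ} (hx : 1 ≤ x) : Gamma (x + 1 / 2) ≤ √π * (x / 2) ^ x := by
  obtain ⟨n, hn⟩ := exists_nat_ge (x - 2)
  induction n generalizing x with
  | zero => exact Gamma_add_half_le_of_le_two hx (by simpa using hn)
  | succ n ih =>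
    rcases le_total x 2 with h | h
    · exact Gamma_add_half_le_of_le_two hx h
    · obtain ⟨y, rfl⟩ : ∃ y, x = y + 1 := ⟨x - 1, by ring⟩
      have hy : 1 ≤ y := by linarith
      push_cast at hn
      calc Gamma (y + 1 + 1 / 2) = (y + 1 / 2) * Gamma (y + 1 / 2) := by
            rw [← Gamma_add_one (by linarith)]
            ring_nf
        _ ≤ (y + 1 / 2) * (√π * (y / 2) ^ y) := by
            gcongr
            exact ih hy (by linarith)
        _ = √π * ((y + 1 / 2) * (y / 2) ^ y) := by ring
        _ ≤ √π * ((y + 1) / 2) ^ (y + 1) := by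
            gcongr
            exact add_half_mul_rpow_self_le hy

/-- The optimal Khintchine constant `C_p = √(2 π^{-1/p}) Γ((p+1)/2)^{1/p}` satisfies
`C_p ≤ √(p/2)` for all `p ≥ 2`, with equality when `p = 2`. -/
theorem khintchine_constant_bound :
    ∀ p : ℝ, 2 ≤ p →
      Real.sqrt (2 * Real.pi ^ (-1 / p)) * Real.Gamma ((p + 1) / 2) ^ (1 / p)
        ≤ Real.sqrt (p / 2)
      ∧ (p = 2 →
        Real.sqrt (2 * Real.pi ^ (-1 / p)) * Real.Gamma ((p + 1) / 2) ^ (1 / p)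
          = Real.sqrt (p / 2)) := by
  intro p hp
  have hp0 : 0 < p := by linarith
  have hpi := Real.pi_pos
  have hG : 0 < Real.Gamma ((p + 1) / 2) := Real.Gamma_pos_of_pos (by linarith)
  have hlog : Real.log (Real.sqrt (2 * Real.pi ^ (-1 / p)) * Real.Gamma ((p + 1) / 2) ^ (1 / p))
      = (Real.log 2 - Real.log Real.pi / p) / 2 + Real.log (Real.Gamma ((p + 1) / 2)) / p := by
    rw [Real.log_mul (by positivity) (by positivity), Real.log_sqrt (by positivity),
      Real.log_mul (by positivity) (by positivity), Real.log_rpow hpi, Real.log_rpow hG]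
    ring
  constructor
  · have h := Real.log_le_log (Real.Gamma_pos_of_pos (by linarith))
      (Gamma_add_half_le (x := p / 2) (by linarith))
    rw [show p / 2 + 1 / 2 = (p + 1) / 2 by ring, Real.log_mul (by positivity) (by positivity),
      Real.log_sqrt hpi.le, Real.log_rpow (by positivity),
      Real.log_div (x := p / 2) (by positivity) (by norm_num)] at h
    rw [← Real.log_le_log_iff (by positivity) (by positivity), hlog, Real.log_sqrt (by positivity)]
    have h' := div_le_div_of_nonneg_right h hp0.le
    have e : (Real.log Real.pi / 2 + p / 2 * (Real.log (p / 2) - Real.log 2)) / p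
        = Real.log Real.pi / p / 2 + (Real.log (p / 2) - Real.log 2) / 2 := by
      field_simp
    rw [e] at h'
    linarith
  · rintro rfl
    refine Real.log_injOn_pos (Set.mem_Ioi.2 (by positivity)) (Set.mem_Ioi.2 (by positivity)) ?_
    rw [hlog, show ((2 : ℝ) + 1) / 2 = 3 / 2 by norm_num, log_Gamma_three_halves]
    norm_num
    ring
end

section
/- Let g : [0,1] → ℝ satisfy g(1−t) = g(t) for all t ∈ [0,1] (symmetry about 1/2), and let n₁, n₂ ∈ ℕ₊. For a function h on [0,1] symmetric about 1/2, let h_{,n} denote its n-fold periodization on [0,1]: h_{,n}(t) = h(nt − j) for t ∈ [j/n, (j+1)/n], j = 0,…,n−1. Let β(t) = ReLU(2t) − 2 ReLU(2t−1) + ReLU(2t−2), where ReLU(t) = max(t,0). Then g_{,n₂} ∘ β_{,n₁} = g_{,2 n₁ n₂} on [0,1]. -/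
/-- The ReLU function. -/
noncomputable def relu (t : ℝ) : ℝ := max t 0

/-- The hat function `β(t) = ReLU(2t) - 2 ReLU(2t-1) + ReLU(2t-2)`. -/
noncomputable def hatβ (t : ℝ) : ℝ := relu (2 * t) - 2 * relu (2 * t - 1) + relu (2 * t - 2)

/-- The `n`-fold periodization on `[0,1]` of a function `h` on `[0,1]` symmetric about
`1/2`: `h_{,n}(t) = h(nt - j)` for `t ∈ [j/n, (j+1)/n]` (realized via the fractional
part, which agrees with this prescription thanks to the symmetry `h(0) = h(1)`). -/
noncomputable def periodize (h : ℝ → ℝ) (n : ℕ) (t : ℝ) : ℝ := h (Int.fract (n * t))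

theorem hatβ_of_le_half {s : ℝ} (h0 : 0 ≤ s) (h : s ≤ 1 / 2) : hatβ s = 2 * s := by
  unfold hatβ relu
  rw [max_eq_left (by linarith), max_eq_right (by linarith), max_eq_right (by linarith)]
  ring

theorem hatβ_of_half_le {s : ℝ} (h : 1 / 2 ≤ s) (h1 : s ≤ 1) : hatβ s = 2 - 2 * s := by
  unfold hatβ relu
  rw [max_eq_left (by linarith), max_eq_left (by linarith), max_eq_right (by linarith)]
  ring

/-- The periodic extension of a function symmetric about `1/2` is even. -/
theorem apply_fract_neg_of_symm {g : ℝ → ℝ} (hg : ∀ t ∈ Set.Icc (0 : ℝ) 1, g (1 - t) = g t)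
    (x : ℝ) : g (Int.fract (-x)) = g (Int.fract x) := by
  by_cases hx : Int.fract x = 0
  · rw [Int.fract_neg_eq_zero.mpr hx, hx]
  · rw [Int.fract_neg hx]
    exact hg _ ⟨Int.fract_nonneg x, (Int.fract_lt_one x).le⟩

/-- Composition with the sawtooth `β_{,n₁}` doubles the oscillation:
`g_{,n₂} ∘ β_{,n₁} = g_{,2 n₁ n₂}` on `[0,1]` for `g` symmetric about `1/2`. -/
theorem periodize_comp_sawtooth
    (g : ℝ → ℝ) (hg : ∀ t ∈ Set.Icc (0 : ℝ) 1, g (1 - t) = g t)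
    (n₁ n₂ : ℕ) (hn₁ : 0 < n₁) (hn₂ : 0 < n₂) :
    ∀ t ∈ Set.Icc (0 : ℝ) 1,
      periodize g n₂ (periodize hatβ n₁ t) = periodize g (2 * n₁ * n₂) t := by
  intro t _
  unfold periodize
  have hfract : Int.fract (((2 * n₁ * n₂ : ℕ) : ℝ) * t) =
      Int.fract (n₂ * (2 * Int.fract (n₁ * t))) := by
    refine Int.fract_eq_fract.mpr ⟨2 * n₂ * ⌊(n₁ : ℝ) * t⌋, ?_⟩
    rw [Int.fract]
    push_cast
    ring
  have h0 := Int.fract_nonneg ((n₁ : ℝ) * t)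
  have h1 := (Int.fract_lt_one ((n₁ : ℝ) * t)).le
  rw [hfract]
  rcases le_total (Int.fract ((n₁ : ℝ) * t)) (1 / 2) with h | h
  · rw [hatβ_of_le_half h0 h]
  · rw [hatβ_of_half_le h h1, ← apply_fract_neg_of_symm hg (n₂ * (2 * _))]
    congr 1
    refine Int.fract_eq_fract.mpr ⟨2 * n₂, ?_⟩
    push_cast
    ring
end

section
/- For r ∈ (0,1), define α(t,r) = ReLU(t) − ReLU(t − r/2) − ReLU(t − (1−r)/2) + ReLU(t − 1/2), and γ(t,r) = α(t + 1/4, r) − α(t − 1/4, r) + α(t − 3/4, r). For n ∈ ℕ₊, let γ_{,n}(·,r) denote the n-fold periodization of γ(·,r) on [0,1], i.e. γ_{,n}(t,r) = γ(nt − j, r) for t ∈ [j/n, (j+1)/n], j = 0,…,n−1 (well defined since γ(·,r) is symmetric about 1/2). Then for every n ∈ ℕ₊ and every t ∈ [0,1], π² ∫_0^1 sin(π r) γ_{,n}(t,r) dr = cos(2π n t). -/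
open MeasureTheory

/-- `α(t,r) = ReLU(t) - ReLU(t - r/2) - ReLU(t - (1-r)/2) + ReLU(t - 1/2)`. -/
noncomputable def bumpα (t r : ℝ) : ℝ :=
  relu t - relu (t - r / 2) - relu (t - (1 - r) / 2) + relu (t - 1 / 2)

/-- `γ(t,r) = α(t + 1/4, r) - α(t - 1/4, r) + α(t - 3/4, r)`. -/
noncomputable def bumpγ (t r : ℝ) : ℝ :=
  bumpα (t + 1 / 4) r - bumpα (t - 1 / 4) r + bumpα (t - 3 / 4) r

/-- The `n`-fold periodization on `[0,1]` of `γ(·,r)`: `γ_{,n}(t,r) = γ(nt - j, r)` for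
`t ∈ [j/n, (j+1)/n]` (realized via the fractional part; well defined since `γ(·,r)` is
symmetric about `1/2`). -/
noncomputable def bumpγper (n : ℕ) (t r : ℝ) : ℝ := bumpγ (Int.fract (n * t)) r

theorem integral_sin_pi_mul_sub_half (t c : ℝ) :
    ∫ r in (0 : ℝ)..c, Real.sin (Real.pi * r) * (t - r / 2)
      = t / Real.pi - (t - c / 2) * Real.cos (Real.pi * c) / Real.pi
        - Real.sin (Real.pi * c) / (2 * Real.pi ^ 2) := by
  have hπ := Real.pi_ne_zero
  have hderiv (r : ℝ) : HasDerivAt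
      (fun r => -((t - r / 2) * Real.cos (Real.pi * r) / Real.pi)
        - Real.sin (Real.pi * r) / (2 * Real.pi ^ 2))
      (Real.sin (Real.pi * r) * (t - r / 2)) r := by
    have hlin : HasDerivAt (fun r => Real.pi * r) Real.pi r := by
      simpa using (hasDerivAt_id r).const_mul Real.pi
    have hcoef : HasDerivAt (fun r => t - r / 2) (-(1 / 2)) r := by
      simpa using ((hasDerivAt_id r).div_const 2).const_sub t
    refine (((hcoef.mul hlin.cos).div_const Real.pi).neg.sub
      (hlin.sin.div_const (2 * Real.pi ^ 2))).congr_deriv ?_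
    field_simp
    ring
  rw [intervalIntegral.integral_eq_sub_of_hasDerivAt (fun r _ => hderiv r)
    (Continuous.intervalIntegrable (by fun_prop) _ _)]
  simp
  ring

theorem continuous_relu : Continuous relu := by
  unfold relu
  fun_prop

theorem relu_of_nonneg {t : ℝ} (ht : 0 ≤ t) : relu t = t := max_eq_left ht

theorem relu_of_nonpos {t : ℝ} (ht : t ≤ 0) : relu t = 0 := max_eq_right ht

theorem intervalIntegrable_sin_mul_relu {f : ℝ → ℝ} (hf : Continuous f) (a b : ℝ) :
    IntervalIntegrable (fun r => Real.sin (Real.pi * r) * relu (f r)) volume a b :=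
  ((Real.continuous_sin.comp (continuous_const.mul continuous_id)).mul
    (continuous_relu.comp hf)).intervalIntegrable _ _

theorem integral_sin_mul_relu_of_nonpos {t : ℝ} (ht : t ≤ 0) :
    ∫ r in (0 : ℝ)..1, Real.sin (Real.pi * r) * relu (t - r / 2) = 0 := by
  rw [intervalIntegral.integral_congr (g := fun _ => (0 : ℝ))]
  · simp
  · intro r hr
    rw [Set.uIcc_of_le zero_le_one] at hr
    have : t - r / 2 ≤ 0 := by linarith [hr.1]
    simp [relu_of_nonpos this]

theorem integral_sin_mul_relu_of_half_le {t : ℝ} (ht : 1 / 2 ≤ t) :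
    ∫ r in (0 : ℝ)..1, Real.sin (Real.pi * r) * relu (t - r / 2)
      = (2 * t - 1 / 2) / Real.pi := by
  rw [intervalIntegral.integral_congr
    (g := fun r => Real.sin (Real.pi * r) * (t - r / 2)), integral_sin_pi_mul_sub_half]
  · simp
    ring
  · intro r hr
    rw [Set.uIcc_of_le zero_le_one] at hr
    have : 0 ≤ t - r / 2 := by linarith [hr.2]
    simp [relu_of_nonneg this]

theorem integral_sin_mul_relu_of_mem_Icc {t : ℝ} (ht : t ∈ Set.Icc (0 : ℝ) (1 / 2)) :
    ∫ r in (0 : ℝ)..1, Real.sin (Real.pi * r) * relu (t - r / 2)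
      = t / Real.pi - Real.sin (2 * Real.pi * t) / (2 * Real.pi ^ 2) := by
  obtain ⟨h0, h1⟩ := ht
  have hcont : Continuous fun r : ℝ => t - r / 2 := by fun_prop
  rw [← intervalIntegral.integral_add_adjacent_intervals
    (intervalIntegrable_sin_mul_relu hcont 0 (2 * t))
    (intervalIntegrable_sin_mul_relu hcont (2 * t) 1),
    intervalIntegral.integral_congr (a := 0) (b := 2 * t)
      (g := fun r => Real.sin (Real.pi * r) * (t - r / 2)),
    intervalIntegral.integral_congr (a := 2 * t) (b := 1) (g := fun _ => (0 : ℝ)),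
    integral_sin_pi_mul_sub_half]
  · rw [show Real.pi * (2 * t) = 2 * Real.pi * t by ring]
    simp
  · intro r hr
    rw [Set.uIcc_of_le (by linarith)] at hr
    have : t - r / 2 ≤ 0 := by linarith [hr.1]
    simp [relu_of_nonpos this]
  · intro r hr
    rw [Set.uIcc_of_le (by linarith)] at hr
    have : 0 ≤ t - r / 2 := by linarith [hr.2]
    simp [relu_of_nonneg this]

theorem intervalIntegrable_sin_mul_bumpα (t a b : ℝ) :
    IntervalIntegrable (fun r => Real.sin (Real.pi * r) * bumpα t r) volume a b := by
  have := continuous_relu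
  unfold bumpα
  exact Continuous.intervalIntegrable (by fun_prop) _ _

theorem integral_sin_mul_bumpα (t : ℝ) :
    ∫ r in (0 : ℝ)..1, Real.sin (Real.pi * r) * bumpα t r
      = 2 / Real.pi * (relu t + relu (t - 1 / 2))
        - 2 * ∫ r in (0 : ℝ)..1, Real.sin (Real.pi * r) * relu (t - r / 2) := by
  have hreflect : ∫ r in (0 : ℝ)..1, Real.sin (Real.pi * r) * relu (t - (1 - r) / 2)
      = ∫ r in (0 : ℝ)..1, Real.sin (Real.pi * r) * relu (t - r / 2) := by
    have h := intervalIntegral.integral_comp_sub_left (a := 0) (b := 1)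
      (fun r => Real.sin (Real.pi * r) * relu (t - r / 2)) 1
    simpa [mul_sub, Real.sin_pi_sub] using h
  have hsin : ∫ r in (0 : ℝ)..1, Real.sin (Real.pi * r) = 2 / Real.pi := by
    rw [intervalIntegral.integral_comp_mul_left _ Real.pi_ne_zero]
    simp
    ring
  have hexpand (r : ℝ) : Real.sin (Real.pi * r) * bumpα t r
      = Real.sin (Real.pi * r) * (relu t + relu (t - 1 / 2))
        - Real.sin (Real.pi * r) * relu (t - r / 2)
        - Real.sin (Real.pi * r) * relu (t - (1 - r) / 2) := by
    unfold bumpα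
    ring
  have hconst : IntervalIntegrable
      (fun r => Real.sin (Real.pi * r) * (relu t + relu (t - 1 / 2))) volume 0 1 :=
    Continuous.intervalIntegrable (by fun_prop) _ _
  have hhalf := intervalIntegrable_sin_mul_relu (f := fun r => t - r / 2) (by fun_prop) 0 1
  have hrefl := intervalIntegrable_sin_mul_relu (f := fun r => t - (1 - r) / 2)
    (by fun_prop) 0 1
  simp_rw [hexpand]
  rw [intervalIntegral.integral_sub (hconst.sub hhalf) hrefl,
    intervalIntegral.integral_sub hconst hhalf, hreflect,
    intervalIntegral.integral_mul_const, hsin]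
  ring

theorem integral_sin_mul_bumpα_of_mem_Icc {t : ℝ} (ht : t ∈ Set.Icc (0 : ℝ) (1 / 2)) :
    ∫ r in (0 : ℝ)..1, Real.sin (Real.pi * r) * bumpα t r
      = Real.sin (2 * Real.pi * t) / Real.pi ^ 2 := by
  rw [integral_sin_mul_bumpα, integral_sin_mul_relu_of_mem_Icc ht, relu_of_nonneg ht.1,
    relu_of_nonpos (sub_nonpos.2 ht.2)]
  field_simp
  ring

theorem integral_sin_mul_bumpα_of_nonpos {t : ℝ} (ht : t ≤ 0) :
    ∫ r in (0 : ℝ)..1, Real.sin (Real.pi * r) * bumpα t r = 0 := by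
  rw [integral_sin_mul_bumpα, integral_sin_mul_relu_of_nonpos ht, relu_of_nonpos ht,
    relu_of_nonpos (by linarith)]
  ring

theorem integral_sin_mul_bumpα_of_half_le {t : ℝ} (ht : 1 / 2 ≤ t) :
    ∫ r in (0 : ℝ)..1, Real.sin (Real.pi * r) * bumpα t r = 0 := by
  rw [integral_sin_mul_bumpα, integral_sin_mul_relu_of_half_le ht,
    relu_of_nonneg (by linarith), relu_of_nonneg (sub_nonneg.2 ht)]
  ring

theorem integral_sin_mul_bumpγ {x : ℝ} (hx : x ∈ Set.Icc (0 : ℝ) 1) :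
    ∫ r in (0 : ℝ)..1, Real.sin (Real.pi * r) * bumpγ x r
      = Real.cos (2 * Real.pi * x) / Real.pi ^ 2 := by
  obtain ⟨h0, h1⟩ := hx
  have hint (s : ℝ) := intervalIntegrable_sin_mul_bumpα s 0 1
  simp_rw [bumpγ, mul_add, mul_sub]
  rw [intervalIntegral.integral_add ((hint _).sub (hint _)) (hint _),
    intervalIntegral.integral_sub (hint _) (hint _)]
  rcases le_total x (1 / 4) with h | h
  · rw [integral_sin_mul_bumpα_of_mem_Icc ⟨by linarith, by linarith⟩,
      integral_sin_mul_bumpα_of_nonpos (by linarith),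
      integral_sin_mul_bumpα_of_nonpos (by linarith),
      show 2 * Real.pi * (x + 1 / 4) = 2 * Real.pi * x + Real.pi / 2 by ring,
      Real.sin_add_pi_div_two]
    ring
  rcases le_total x (3 / 4) with h' | h'
  · rw [integral_sin_mul_bumpα_of_half_le (by linarith),
      integral_sin_mul_bumpα_of_mem_Icc ⟨by linarith, by linarith⟩,
      integral_sin_mul_bumpα_of_nonpos (by linarith),
      show 2 * Real.pi * (x - 1 / 4) = 2 * Real.pi * x - Real.pi / 2 by ring,
      Real.sin_sub_pi_div_two]
    ring
  · rw [integral_sin_mul_bumpα_of_half_le (by linarith),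
      integral_sin_mul_bumpα_of_half_le (by linarith),
      integral_sin_mul_bumpα_of_mem_Icc ⟨by linarith, by linarith⟩,
      show 2 * Real.pi * (x - 3 / 4) = 2 * Real.pi * x + Real.pi / 2 - 2 * Real.pi by ring,
      Real.sin_sub_two_pi, Real.sin_add_pi_div_two]
    ring

/-- Integral representation of the cosine:
`π² ∫₀¹ sin(π r) γ_{,n}(t, r) dr = cos(2π n t)` for `t ∈ [0,1]`. -/
theorem integral_sin_bumpγper_eq_cos
    (n : ℕ) (hn : 0 < n) (t : ℝ) (ht : t ∈ Set.Icc (0 : ℝ) 1) :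
    Real.pi ^ 2 * ∫ r in Set.Ioo (0 : ℝ) 1, Real.sin (Real.pi * r) * bumpγper n t r
      = Real.cos (2 * Real.pi * n * t) := by
  rw [← integral_Ioc_eq_integral_Ioo, ← intervalIntegral.integral_of_le zero_le_one]
  simp_rw [bumpγper]
  rw [integral_sin_mul_bumpγ ⟨Int.fract_nonneg _, (Int.fract_lt_one _).le⟩,
    mul_div_cancel₀ _ (pow_ne_zero 2 Real.pi_ne_zero), Int.fract,
    show 2 * Real.pi * (n * t - ⌊(n : ℝ) * t⌋)
      = 2 * Real.pi * n * t - ⌊(n : ℝ) * t⌋ * (2 * Real.pi) by ring,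
    Real.cos_sub_int_mul_two_pi]
end

section
/- Let d ∈ ℕ₊, α ∈ (0,1), and s ≥ 0. Then the integral ∫_{ℝ^d} (1 + |ξ|₁)^s (1 + 4π² |ξ|²)^{−(α+d)/2} dξ is finite if and only if s < α, where |ξ|₁ is the ℓ¹-norm and |ξ| the Euclidean norm of ξ. Consequently, the Bessel potential f(x) = ∫_{ℝ^d} (1 + 4π²|ξ|²)^{−(α+d)/2} e^{2πi ξ·x} dξ belongs to the spectral Barron space B^s(ℝ^d) if and only if s < α. -/
open MeasureTheory

/-- The `ℓ¹`-norm on `ℝ^d`. -/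
noncomputable def l1norm {d : ℕ} (ξ : Fin d → ℝ) : ℝ := ∑ i, |ξ i|

/-- On a nontrivial finite-dimensional real space, `(1 + ‖x‖) ^ (-r)` is integrable exactly when
`r` exceeds the dimension. -/
theorem integrable_one_add_norm_iff {E : Type*} [NormedAddCommGroup E] [NormedSpace ℝ E]
    [FiniteDimensional ℝ E] [Nontrivial E] [MeasurableSpace E] [BorelSpace E]
    (μ : Measure E) [μ.IsAddHaarMeasure] {r : ℝ} :
    Integrable (fun x : E => (1 + ‖x‖) ^ (-r)) μ ↔ (Module.finrank ℝ E : ℝ) < r := by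
  refine ⟨fun h => ?_, fun h => integrable_one_add_norm h⟩
  by_contra! hr
  have h' := (integrable_fun_norm_addHaar μ (f := fun y : ℝ => (1 + y) ^ (-r))).1 h
  set n := Module.finrank ℝ E with hn
  have hn0 : 0 < n := Module.finrank_pos
  refine not_integrableOn_Ioi_inv (a := (1 : ℝ)) ?_
  refine ((h'.mono_set (Set.Ioi_subset_Ioi zero_le_one)).const_mul ((2 : ℝ) ^ n)).mono'
    measurable_inv.aestronglyMeasurable ?_
  refine (ae_restrict_iff' measurableSet_Ioi).2 (.of_forall fun y (hy : 1 < y) => ?_)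
  have hy0 : 0 < y := by linarith
  rw [Real.norm_of_nonneg (by positivity), smul_eq_mul]
  have h1 : ((2 * y) ^ n)⁻¹ ≤ (1 + y) ^ (-r) := by
    rw [← Real.rpow_natCast, ← Real.rpow_neg (by positivity)]
    calc (2 * y) ^ (-(n : ℝ)) ≤ (1 + y) ^ (-(n : ℝ)) :=
          Real.rpow_le_rpow_of_nonpos (by positivity) (by linarith) (by simp)
      _ ≤ (1 + y) ^ (-r) := Real.rpow_le_rpow_of_exponent_le (by linarith) (by linarith)
  calc y⁻¹ = 2 ^ n * (y ^ (n - 1) * ((2 * y) ^ n)⁻¹) := by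
        obtain ⟨m, hm⟩ := Nat.exists_eq_succ_of_ne_zero hn0.ne'
        rw [hm, Nat.succ_sub_one, mul_pow, pow_succ y]
        field_simp
    _ ≤ _ := by gcongr

theorem norm_le_l1norm {d : ℕ} (ξ : Fin d → ℝ) : ‖ξ‖ ≤ l1norm ξ :=
  (pi_norm_le_iff_of_nonneg (Finset.sum_nonneg fun _ _ => abs_nonneg _)).2 fun i =>
    Finset.single_le_sum (f := fun i => |ξ i|) (fun _ _ => abs_nonneg _) (Finset.mem_univ i)

theorem l1norm_le_card_mul_norm {d : ℕ} (ξ : Fin d → ℝ) : l1norm ξ ≤ d * ‖ξ‖ := by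
  simpa [l1norm] using Finset.sum_le_card_nsmul Finset.univ (fun i => |ξ i|) ‖ξ‖
    fun i _ => norm_le_pi_norm ξ i

theorem sq_norm_le_sum_sq {d : ℕ} (ξ : Fin d → ℝ) : ‖ξ‖ ^ 2 ≤ ∑ i, ξ i ^ 2 := by
  have hS : 0 ≤ ∑ i, ξ i ^ 2 := Finset.sum_nonneg fun _ _ => sq_nonneg _
  refine (Real.le_sqrt (norm_nonneg _) hS).1 ((pi_norm_le_iff_of_nonneg (Real.sqrt_nonneg _)).2
    fun i => Real.abs_le_sqrt ?_)
  exact Finset.single_le_sum (f := fun i => ξ i ^ 2) (fun _ _ => sq_nonneg _) (Finset.mem_univ i)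

theorem sum_sq_le_card_mul_sq_norm {d : ℕ} (ξ : Fin d → ℝ) : ∑ i, ξ i ^ 2 ≤ d * ‖ξ‖ ^ 2 := by
  simpa using Finset.sum_le_card_nsmul Finset.univ (fun i => ξ i ^ 2) (‖ξ‖ ^ 2)
    fun i _ => sq_le_sq.2 (by simpa using norm_le_pi_norm ξ i)

/-- The spectral Barron norm of the Bessel potential of order `α + d` is finite if
and only if `s < α`: the integral `∫ (1+|ξ|₁)^s (1+4π²|ξ|²)^{-(α+d)/2} dξ` is finite
(equivalently, the integrand is integrable) iff `s < α`. -/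
theorem bessel_potential_barron_iff
    (d : ℕ) (hd : 0 < d) (α : ℝ) (hα0 : 0 < α) (hα1 : α < 1) (s : ℝ) (hs : 0 ≤ s) :
    (Integrable fun ξ : Fin d → ℝ =>
      (1 + l1norm ξ) ^ s *
        (1 + 4 * Real.pi ^ 2 * (∑ i, ξ i ^ 2)) ^ (-(α + d) / 2)) ↔ s < α := by
  have : Nonempty (Fin d) := ⟨⟨0, hd⟩⟩
  have hd1 : (1 : ℝ) ≤ d := by exact_mod_cast hd
  have hpi : 1 ≤ 4 * Real.pi ^ 2 := by nlinarith [Real.pi_gt_three]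
  have hp : -(α + d) / 2 ≤ 0 := by linarith
  have hpow (ξ : Fin d → ℝ) :
      (1 + ‖ξ‖) ^ (-(α + d - s)) = (1 + ‖ξ‖) ^ s * ((1 + ‖ξ‖) ^ 2) ^ (-(α + d) / 2) := by
    rw [← Real.rpow_natCast, ← Real.rpow_mul (by positivity), ← Real.rpow_add (by positivity)]
    congr 1
    push_cast
    ring
  have hmeas : Measurable fun ξ : Fin d → ℝ =>
      (1 + l1norm ξ) ^ s * (1 + 4 * Real.pi ^ 2 * (∑ i, ξ i ^ 2)) ^ (-(α + d) / 2) := by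
    unfold l1norm
    fun_prop
  have hl (ξ : Fin d → ℝ) : 0 ≤ l1norm ξ := (norm_nonneg ξ).trans (norm_le_l1norm ξ)
  have hS (ξ : Fin d → ℝ) : 0 ≤ ∑ i, ξ i ^ 2 := (sq_nonneg _).trans (sq_norm_le_sum_sq ξ)
  have key : (Integrable fun ξ : Fin d → ℝ => (1 + ‖ξ‖) ^ (-(α + d - s))) ↔ s < α := by
    rw [integrable_one_add_norm_iff, Module.finrank_fin_fun]
    constructor <;> intro h <;> linarith
  rw [← key]
  constructor
  · intro h
    refine (h.const_mul ((4 * Real.pi ^ 2 * d) ^ (-(α + d) / 2))⁻¹).mono'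
      (Measurable.aestronglyMeasurable (by fun_prop)) (.of_forall fun ξ => ?_)
    rw [Real.norm_of_nonneg (by positivity), hpow, le_inv_mul_iff₀ (by positivity), mul_left_comm,
      ← Real.mul_rpow (by positivity) (by positivity)]
    have hξ := hl ξ
    have hξ' := hS ξ
    refine mul_le_mul (Real.rpow_le_rpow (by positivity) (by linarith [norm_le_l1norm ξ]) hs)
      (Real.rpow_le_rpow_of_nonpos (by positivity) ?_ hp) (by positivity) (by positivity)
    have hK : 1 ≤ 4 * Real.pi ^ 2 * d := one_le_mul_of_one_le_of_one_le hpi hd1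
    calc 1 + 4 * Real.pi ^ 2 * ∑ i, ξ i ^ 2
        ≤ 4 * Real.pi ^ 2 * d + 4 * Real.pi ^ 2 * (d * ‖ξ‖ ^ 2) := by
          gcongr
          exact sum_sq_le_card_mul_sq_norm ξ
      _ = 4 * Real.pi ^ 2 * d * (1 + ‖ξ‖ ^ 2) := by ring
      _ ≤ 4 * Real.pi ^ 2 * d * (1 + ‖ξ‖) ^ 2 := by
          gcongr
          nlinarith [norm_nonneg ξ]
  · intro h
    refine (h.const_mul ((d : ℝ) ^ s * (1 / 2 : ℝ) ^ (-(α + d) / 2))).mono'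
      hmeas.aestronglyMeasurable (.of_forall fun ξ => ?_)
    have hξ := hl ξ
    have hξ' := hS ξ
    rw [Real.norm_of_nonneg (by positivity), hpow, mul_mul_mul_comm,
      ← Real.mul_rpow (by positivity) (by positivity),
      ← Real.mul_rpow (by positivity) (by positivity)]
    refine mul_le_mul (Real.rpow_le_rpow (by positivity) ?_ hs)
      (Real.rpow_le_rpow_of_nonpos (by positivity) ?_ hp) (by positivity) (by positivity)
    · linarith [l1norm_le_card_mul_norm ξ]
    · have h1 := mul_le_mul hpi (sq_norm_le_sum_sq ξ) (sq_nonneg _) (by positivity)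
      nlinarith [sq_nonneg (‖ξ‖ - 1)]
end

section
/- Let d ∈ ℕ₊, α ∈ (0,1), and let f : ℝ^d → ℝ be the Bessel potential f(x) = ∫_{ℝ^d} (1 + 4π²|ξ|²)^{−(α+d)/2} e^{2πi ξ·x} dξ (the integral is real since the integrand is radial). Then for every x ∈ ℝ^d, f(x) = [Γ((α+1)/2) / (2^d π^{(d+1)/2} Γ((α+d)/2))] · ∫_ℝ (1 + ξ²)^{−(α+1)/2} cos(|x| ξ) dξ, where |x| is the Euclidean norm and Γ is the Gamma function. -/
open MeasureTheory

/-- Dot product on `ℝ^d`. -/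
def dot {d : ℕ} (w x : Fin d → ℝ) : ℝ := ∑ i, w i * x i

open scoped RealInnerProductSpace

section GaussianSubordination

variable {V : Type*} [NormedAddCommGroup V] [InnerProductSpace ℝ V]

/-- The Gaussian kernel appearing in the subordination formula for
`(1 + b * ‖v‖ ^ 2) ^ (-s) * exp (i ⟪w, v⟫)`. -/
noncomputable def gaussianSubordinationKernel (b s : ℝ) (w v : V) (t : ℝ) : ℂ :=
  (t ^ (s - 1) * Real.exp (-t) : ℝ) *
    Complex.exp (-(b * t : ℝ) * (‖v‖ : ℂ) ^ 2 + Complex.I * ⟪w, v⟫)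

lemma norm_gaussianSubordinationKernel (b s : ℝ) (w v : V) {t : ℝ} (ht : 0 < t) :
    ‖gaussianSubordinationKernel b s w v t‖ =
      t ^ (s - 1) * Real.exp (-t) * Real.exp (-(b * t) * ‖v‖ ^ 2) := by
  rw [gaussianSubordinationKernel, norm_mul, Complex.norm_exp, Complex.norm_real,
    Real.norm_of_nonneg (by positivity)]
  congr 2
  simp [← Complex.ofReal_pow]

lemma rpow_sub_one_mul_div_rpow {b s n t : ℝ} (hb : 0 < b) (ht : 0 < t) :
    t ^ (s - 1) * (Real.pi / (b * t)) ^ n = (Real.pi / b) ^ n * t ^ (s - n - 1) := by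
  rw [← div_div, Real.div_rpow (by positivity) ht.le,
    show s - n - 1 = s - 1 - n by ring, Real.rpow_sub ht (s - 1) n]
  ring

lemma integral_gaussianSubordinationKernel_Ioi {b s : ℝ} (hb : 0 < b) (hs : 0 < s) (w v : V) :
    ∫ t in Set.Ioi (0 : ℝ), gaussianSubordinationKernel b s w v t =
      Real.Gamma s * (((1 + b * ‖v‖ ^ 2) ^ (-s) : ℝ) * Complex.exp (Complex.I * ⟪w, v⟫)) := by
  have h1 : 0 < 1 + b * ‖v‖ ^ 2 := by positivity
  have h : ∀ t : ℝ, gaussianSubordinationKernel b s w v t =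
      ((t ^ (s - 1) * Real.exp (-((1 + b * ‖v‖ ^ 2) * t)) : ℝ) : ℂ) *
        Complex.exp (Complex.I * ⟪w, v⟫) := fun t ↦ by
    rw [gaussianSubordinationKernel, Complex.exp_add, ← mul_assoc,
      show -((1 + b * ‖v‖ ^ 2) * t) = -t + -(b * t) * ‖v‖ ^ 2 by ring, Real.exp_add]
    push_cast
    ring
  simp_rw [h]
  rw [integral_mul_const, integral_complex_ofReal, Real.integral_rpow_mul_exp_neg_mul_Ioi hs h1,
    one_div, Real.inv_rpow h1.le, ← Real.rpow_neg h1.le]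
  push_cast
  ring

variable [FiniteDimensional ℝ V] [MeasurableSpace V] [BorelSpace V]

lemma integral_gaussianSubordinationKernel {b s : ℝ} (hb : 0 < b) (w : V) {t : ℝ} (ht : 0 < t) :
    ∫ v, gaussianSubordinationKernel b s w v t =
      (((Real.pi / b) ^ (Module.finrank ℝ V / 2 : ℝ) * (t ^ (s - Module.finrank ℝ V / 2 - 1) *
        Real.exp (-t) * Real.exp (-(‖w‖ ^ 2 / (4 * b * t)))) : ℝ) : ℂ) := by
  have hbt : 0 < ((b * t : ℝ) : ℂ).re := by rw [Complex.ofReal_re]; positivity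
  simp_rw [gaussianSubordinationKernel]
  rw [integral_const_mul, GaussianFourier.integral_cexp_neg_mul_sq_norm_add hbt]
  have h : ((Real.pi : ℂ) / (b * t : ℝ)) ^ (Module.finrank ℝ V / 2 : ℂ) =
      ((Real.pi / (b * t)) ^ (Module.finrank ℝ V / 2 : ℝ) : ℝ) := by
    rw [Complex.ofReal_cpow (by positivity)]
    push_cast
    rfl
  have h2 : Complex.exp (Complex.I ^ 2 * (‖w‖ : ℂ) ^ 2 / (4 * (b * t : ℝ))) =
      (Real.exp (-(‖w‖ ^ 2 / (4 * b * t))) : ℝ) := by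
    rw [Complex.I_sq]
    push_cast
    congr 1
    ring
  rw [h, h2, ← Complex.ofReal_mul, ← Complex.ofReal_mul]
  congr 1
  have := rpow_sub_one_mul_div_rpow (s := s) (n := Module.finrank ℝ V / 2) hb ht
  linear_combination Real.exp (-t) * Real.exp (-(‖w‖ ^ 2 / (4 * b * t))) * this

lemma integrable_gaussianSubordinationKernel {b s : ℝ} (hb : 0 < b)
    (hs : (Module.finrank ℝ V / 2 : ℝ) < s) (w : V) :
    Integrable (Function.uncurry (gaussianSubordinationKernel b s w))
      (volume.prod (volume.restrict (Set.Ioi (0 : ℝ)))) := by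
  have hmeas : Measurable (Function.uncurry (gaussianSubordinationKernel b s w)) := by
    unfold gaussianSubordinationKernel Function.uncurry
    fun_prop
  rw [integrable_prod_iff' hmeas.aestronglyMeasurable]
  constructor
  · filter_upwards [ae_restrict_mem measurableSet_Ioi] with t ht
    have ht : 0 < t := ht
    exact (GaussianFourier.integrable_cexp_neg_mul_sq_norm_add
      (b := ((b * t : ℝ) : ℂ)) (by rw [Complex.ofReal_re]; positivity) Complex.I w).const_mul
        ((t ^ (s - 1) * Real.exp (-t) : ℝ) : ℂ)
  · have key := (Real.GammaIntegral_convergent (sub_pos.2 hs)).const_mul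
      ((Real.pi / b) ^ (Module.finrank ℝ V / 2 : ℝ))
    refine key.congr ?_
    filter_upwards [ae_restrict_mem measurableSet_Ioi] with t ht
    have ht : 0 < t := ht
    simp only [Function.uncurry, norm_gaussianSubordinationKernel b s w _ ht]
    rw [integral_const_mul, GaussianFourier.integral_rexp_neg_mul_sq_norm (mul_pos hb ht)]
    have := rpow_sub_one_mul_div_rpow (s := s) (n := Module.finrank ℝ V / 2) hb ht
    linear_combination -Real.exp (-t) * this

/-- The Fourier transform of `(1 + b * ‖v‖ ^ 2) ^ (-s)`, as a superposition of Gaussians. -/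
theorem integral_one_add_mul_norm_sq_rpow_mul_cexp {b s : ℝ} (hb : 0 < b)
    (hs : (Module.finrank ℝ V / 2 : ℝ) < s) (w : V) :
    ∫ v : V, (((1 + b * ‖v‖ ^ 2) ^ (-s) : ℝ) : ℂ) * Complex.exp (Complex.I * ⟪w, v⟫) =
      (((Real.pi / b) ^ (Module.finrank ℝ V / 2 : ℝ) / Real.Gamma s *
        ∫ t in Set.Ioi (0 : ℝ), t ^ (s - Module.finrank ℝ V / 2 - 1) * Real.exp (-t) *
          Real.exp (-(‖w‖ ^ 2 / (4 * b * t))) : ℝ) : ℂ) := by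
  have hs0 : 0 < s := lt_of_le_of_lt (by positivity) hs
  have hΓ : (Real.Gamma s : ℂ) ≠ 0 := Complex.ofReal_ne_zero.2 (Real.Gamma_pos_of_pos hs0).ne'
  have key := integral_integral_swap (integrable_gaussianSubordinationKernel hb hs w)
  simp_rw [integral_gaussianSubordinationKernel_Ioi hb hs0] at key
  rw [integral_const_mul, setIntegral_congr_fun measurableSet_Ioi
    (fun t ht ↦ integral_gaussianSubordinationKernel hb w ht), integral_complex_ofReal,
    integral_const_mul] at key
  apply mul_left_cancel₀ hΓ
  rw [key, ← Complex.ofReal_mul]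
  congr 1
  rw [← mul_assoc, mul_div_cancel₀ _ (Real.Gamma_pos_of_pos hs0).ne']

end GaussianSubordination

lemma integral_one_add_sq_rpow_mul_cos {s : ℝ} (hs : 1 / 2 < s) (r : ℝ) :
    ∫ t : ℝ, (1 + t ^ 2) ^ (-s) * Real.cos (r * t) =
      √Real.pi / Real.Gamma s * ∫ t in Set.Ioi (0 : ℝ), t ^ (s - 1 / 2 - 1) * Real.exp (-t) *
        Real.exp (-(r ^ 2 / (4 * t))) := by
  have key := integral_one_add_mul_norm_sq_rpow_mul_cexp (V := ℝ) one_pos (s := s)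
    (by simpa using hs) r
  have hint : Integrable fun t : ℝ ↦ (((1 + 1 * ‖t‖ ^ 2) ^ (-s) : ℝ) : ℂ) *
      Complex.exp (Complex.I * ⟪r, t⟫) := by
    have h := integrable_rpow_neg_one_add_norm_sq (E := ℝ) (μ := volume) (r := 2 * s)
      (by simp; linarith)
    refine (h.congr (g := fun t : ℝ ↦ (1 + 1 * ‖t‖ ^ 2) ^ (-s)) ?_).ofReal.mul_bdd (c := 1) ?_ ?_
    · exact Filter.Eventually.of_forall fun t ↦ by
        simp only [one_mul]
        congr 1
        ring
    · exact Continuous.aestronglyMeasurable (by fun_prop)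
    · exact Filter.Eventually.of_forall fun t ↦ by simp [Complex.norm_exp]
  have hre := congrArg Complex.re key
  rw [Complex.ofReal_re] at hre
  have h2 := integral_re hint
  simp only [RCLike.re_to_complex] at h2
  rw [← h2] at hre
  simp only [Module.finrank_self, Nat.cast_one, div_one, mul_one, one_mul, Real.norm_eq_abs,
    sq_abs, ← Real.sqrt_eq_rpow] at hre
  rw [← hre]
  refine integral_congr_ae (Filter.Eventually.of_forall fun t ↦ ?_)
  simp only [Complex.re_ofReal_mul]
  rw [mul_comm Complex.I, Complex.exp_ofReal_mul_I_re]
  simp [mul_comm]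

/-- Radial representation of the Bessel potential of order `α + d`:
`∫_{ℝ^d} (1+4π²|ξ|²)^{-(α+d)/2} e^{2πi ξ·x} dξ
  = Γ((α+1)/2)/(2^d π^{(d+1)/2} Γ((α+d)/2)) ∫_ℝ (1+ξ²)^{-(α+1)/2} cos(|x|ξ) dξ`. -/
theorem bessel_potential_radial_representation
    (d : ℕ) (hd : 0 < d) (α : ℝ) (hα0 : 0 < α) (hα1 : α < 1) (x : Fin d → ℝ) :
    (∫ ξ : Fin d → ℝ,
        (((1 + 4 * Real.pi ^ 2 * (∑ i, ξ i ^ 2)) ^ (-(α + d) / 2) : ℝ) : ℂ) *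
          Complex.exp (2 * (Real.pi : ℂ) * Complex.I * (dot ξ x : ℝ)))
      = ((Real.Gamma ((α + 1) / 2) /
            (2 ^ d * Real.pi ^ (((d : ℝ) + 1) / 2) * Real.Gamma ((α + d) / 2)) *
          ∫ t : ℝ, (1 + t ^ 2) ^ (-(α + 1) / 2) *
            Real.cos (Real.sqrt (∑ i, x i ^ 2) * t) : ℝ) : ℂ) := by
  set w : EuclideanSpace ℝ (Fin d) := WithLp.toLp 2 fun i ↦ 2 * Real.pi * x i with hw
  have hd' : (0 : ℝ) < d := Nat.cast_pos.2 hd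
  have hsq : ‖w‖ ^ 2 = 4 * Real.pi ^ 2 * ∑ i, x i ^ 2 := by
    rw [EuclideanSpace.real_norm_sq_eq, Finset.mul_sum]
    exact Finset.sum_congr rfl fun i _ ↦ by simp only [hw]; ring
  have key := integral_one_add_mul_norm_sq_rpow_mul_cexp (b := 4 * Real.pi ^ 2) (by positivity)
    (s := (α + d) / 2) (by rw [finrank_euclideanSpace_fin]; linarith) w
  rw [← (PiLp.volume_preserving_toLp (Fin d)).integral_comp
    (MeasurableEquiv.toLp 2 _).measurableEmbedding] at key
  have hlhs : ∀ ξ : Fin d → ℝ,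
      (((1 + 4 * Real.pi ^ 2 * (∑ i, ξ i ^ 2)) ^ (-(α + d) / 2) : ℝ) : ℂ) *
          Complex.exp (2 * (Real.pi : ℂ) * Complex.I * (dot ξ x : ℝ)) =
      (((1 + 4 * Real.pi ^ 2 * ‖WithLp.toLp 2 ξ‖ ^ 2) ^ (-((α + d) / 2)) : ℝ) : ℂ) *
          Complex.exp (Complex.I * ⟪w, WithLp.toLp 2 ξ⟫) := fun ξ ↦ by
    have hinner : ⟪w, WithLp.toLp 2 ξ⟫ = 2 * Real.pi * dot ξ x := by
      simp only [PiLp.inner_apply, hw, dot, Finset.mul_sum, RCLike.inner_apply, conj_trivial]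
      exact Finset.sum_congr rfl fun i _ ↦ by ring
    rw [EuclideanSpace.real_norm_sq_eq, hinner, neg_div]
    push_cast
    congr 2
    ring
  simp_rw [hlhs]
  rw [key]
  congr 1
  rw [neg_div, integral_one_add_sq_rpow_mul_cos (by linarith), Real.sq_sqrt (by positivity),
    finrank_euclideanSpace_fin, hsq, show (α + d) / 2 - d / 2 - 1 = α / 2 - 1 by ring,
    show (α + 1) / 2 - 1 / 2 - 1 = α / 2 - 1 by ring]
  have hexp : ∀ t : ℝ, 4 * Real.pi ^ 2 * (∑ i, x i ^ 2) / (4 * (4 * Real.pi ^ 2) * t) =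
      (∑ i, x i ^ 2) / (4 * t) := fun t ↦ by
    rw [show 4 * (4 * Real.pi ^ 2) * t = 4 * Real.pi ^ 2 * (4 * t) by ring,
      mul_div_mul_left _ _ (by positivity)]
  simp_rw [hexp]
  rw [← mul_assoc]
  congr 1
  have hΓ1 := (Real.Gamma_pos_of_pos (s := (α + 1) / 2) (by linarith)).ne'
  have hΓd := (Real.Gamma_pos_of_pos (s := (α + d) / 2) (by linarith)).ne'
  have hpi : (Real.pi / (4 * Real.pi ^ 2)) ^ ((d : ℝ) / 2) =
      1 / (2 ^ d * Real.pi ^ ((d : ℝ) / 2)) := by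
    rw [show Real.pi / (4 * Real.pi ^ 2) = (2 ^ 2 * Real.pi)⁻¹ by field_simp; norm_num,
      Real.inv_rpow (by positivity), Real.mul_rpow (by positivity) Real.pi_pos.le,
      ← Real.rpow_natCast 2 2, ← Real.rpow_mul (by norm_num),
      show ((2 : ℕ) : ℝ) * (d / 2) = d by push_cast; ring, Real.rpow_natCast, one_div]
  rw [hpi, add_div (d : ℝ) 1 2, Real.rpow_add Real.pi_pos, ← Real.sqrt_eq_rpow]
  field_simp
end

section
/- Let d ∈ ℕ₊, α ∈ (0,1), and let f : ℝ^d → ℝ be the Bessel potential f(x) = ∫_{ℝ^d} (1 + 4π²|ξ|²)^{−(α+d)/2} e^{2πi ξ·x} dξ. Then for every s with 0 < s ≤ α there exists a constant C > 0 (depending only on d, α, s) such that |f(x) − f(y)| ≤ C |x − y|^s for all x, y ∈ ℝ^d, where |·| is the Euclidean norm; i.e., f ∈ C^s(ℝ^d). -/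
open MeasureTheory

/-- The Bessel potential of order `α + d`, i.e.
`f(x) = ∫_{ℝ^d} (1+4π²|ξ|²)^{-(α+d)/2} e^{2πi ξ·x} dξ` (real-valued since the
integrand is radial; we take the real part). -/
noncomputable def besselPotential (d : ℕ) (α : ℝ) (x : Fin d → ℝ) : ℝ :=
  (∫ ξ : Fin d → ℝ,
    (((1 + 4 * Real.pi ^ 2 * (∑ i, ξ i ^ 2)) ^ (-(α + d) / 2) : ℝ) : ℂ) *
      Complex.exp (2 * (Real.pi : ℂ) * Complex.I * (dot ξ x : ℝ))).re

/-- The Euclidean norm on `ℝ^d` dominates the supremum norm. -/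
lemma sq_pi_norm_le_sum_sq {d : ℕ} (x : Fin d → ℝ) : ‖x‖ ^ 2 ≤ ∑ i, x i ^ 2 := by
  have h : ‖x‖ ≤ Real.sqrt (∑ i, x i ^ 2) := by
    refine (pi_norm_le_iff_of_nonneg (Real.sqrt_nonneg _)).2 fun i => ?_
    refine Real.le_sqrt_of_sq_le ?_
    rw [Real.norm_eq_abs, sq_abs]
    exact Finset.single_le_sum (f := fun i => x i ^ 2) (fun i _ => sq_nonneg _) (Finset.mem_univ i)
  exact (Real.le_sqrt (norm_nonneg _) (Finset.sum_nonneg fun i _ => sq_nonneg _)).1 h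

lemma abs_dot_le {d : ℕ} (w x : Fin d → ℝ) : |dot w x| ≤ d * (‖w‖ * ‖x‖) := by
  refine (Finset.abs_sum_le_sum_abs _ _).trans ?_
  have h : ∀ i ∈ Finset.univ, |w i * x i| ≤ ‖w‖ * ‖x‖ := fun i _ => by
    rw [abs_mul]
    exact mul_le_mul (norm_le_pi_norm w i) (norm_le_pi_norm x i) (abs_nonneg _) (norm_nonneg _)
  simpa using Finset.sum_le_card_nsmul _ _ _ h

lemma dot_sub_right {d : ℕ} (w x y : Fin d → ℝ) : dot w (x - y) = dot w x - dot w y := by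
  simp [dot, mul_sub]

/-- Two characters differ by at most `2` and at most by the difference of the phases. -/
lemma norm_exp_dot_sub_exp_dot_le {d : ℕ} (ξ x y : Fin d → ℝ) {r : ℝ} (hr : ‖x - y‖ ≤ r) :
    ‖Complex.exp (2 * (Real.pi : ℂ) * Complex.I * (dot ξ x : ℝ)) -
      Complex.exp (2 * (Real.pi : ℂ) * Complex.I * (dot ξ y : ℝ))‖
      ≤ (2 + 2 * Real.pi * d) * min 1 (r * ‖ξ‖) := by
  have hπ := Real.pi_pos
  have hr0 : 0 ≤ r := (norm_nonneg _).trans hr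
  have harg : ∀ z : Fin d → ℝ, 2 * (Real.pi : ℂ) * Complex.I * (dot ξ z : ℝ) =
      Complex.I * ((2 * Real.pi * dot ξ z : ℝ) : ℂ) := fun z => by push_cast; ring
  have hnorm : ∀ t : ℝ, ‖Complex.exp (Complex.I * (t : ℂ))‖ = 1 := fun t => by
    rw [mul_comm, Complex.norm_exp_ofReal_mul_I]
  rw [harg, harg]
  rw [mul_min_of_nonneg _ _ (by positivity)]
  refine le_min ?_ ?_
  · refine (norm_sub_le _ _).trans ?_
    rw [hnorm, hnorm]
    have : 0 ≤ 2 * Real.pi * d := by positivity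
    linarith
  · have hfac : Complex.exp (Complex.I * ((2 * Real.pi * dot ξ x : ℝ) : ℂ)) -
        Complex.exp (Complex.I * ((2 * Real.pi * dot ξ y : ℝ) : ℂ)) =
        Complex.exp (Complex.I * ((2 * Real.pi * dot ξ y : ℝ) : ℂ)) *
          (Complex.exp (Complex.I * ((2 * Real.pi * dot ξ (x - y) : ℝ) : ℂ)) - 1) := by
      rw [mul_sub, ← Complex.exp_add, dot_sub_right, mul_one]
      congr 2
      push_cast
      ring
    rw [hfac, norm_mul, hnorm, one_mul]
    refine Real.norm_exp_I_mul_ofReal_sub_one_le.trans ?_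
    rw [Real.norm_eq_abs, abs_mul, abs_of_pos (by positivity : 0 < 2 * Real.pi)]
    have h1 := abs_dot_le ξ (x - y)
    have h2 : ‖ξ‖ * ‖x - y‖ ≤ r * ‖ξ‖ := by
      rw [mul_comm]; exact mul_le_mul_of_nonneg_right hr (norm_nonneg _)
    calc 2 * Real.pi * |dot ξ (x - y)| ≤ 2 * Real.pi * (d * (r * ‖ξ‖)) := by
          gcongr
          exact h1.trans (by gcongr)
      _ ≤ (2 + 2 * Real.pi * d) * (r * ‖ξ‖) := by
          have : 0 ≤ r * ‖ξ‖ := by positivity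
          nlinarith

lemma integrable_min_one_norm_mul_rpow {d : ℕ} (hd : 0 < d) {α : ℝ} (hα0 : 0 < α) (hα1 : α < 1) :
    Integrable (fun ξ : Fin d → ℝ => min 1 ‖ξ‖ * ‖ξ‖ ^ (-(α + d))) := by
  have : Nonempty (Fin d) := ⟨⟨0, hd⟩⟩
  rw [integrable_fun_norm_addHaar volume (f := fun t : ℝ => min 1 t * t ^ (-(α + d)))]
  simp only [Module.finrank_fintype_fun_eq_card, Fintype.card_fin, smul_eq_mul]
  have hpow : ∀ y : ℝ, 0 < y → y ^ (d - 1) = y ^ ((d : ℝ) - 1) := fun y _ => by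
    rw [← Nat.cast_pred hd, Real.rpow_natCast]
  rw [← Set.Ioc_union_Ioi_eq_Ioi zero_le_one]
  refine IntegrableOn.union ?_ ?_
  · have h : IntegrableOn (fun y : ℝ => y ^ (-α)) (Set.Ioc 0 1) :=
      (intervalIntegrable_iff_integrableOn_Ioc_of_le zero_le_one).1
        (intervalIntegral.intervalIntegrable_rpow' (by linarith))
    refine h.congr_fun (fun y hy => ?_) measurableSet_Ioc
    simp only
    rw [min_eq_right hy.2, hpow y hy.1]
    nth_rw 3 [← Real.rpow_one y]
    rw [← Real.rpow_add hy.1, ← Real.rpow_add hy.1]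
    ring_nf
  · have h : IntegrableOn (fun y : ℝ => y ^ (-1 - α)) (Set.Ioi 1) :=
      integrableOn_Ioi_rpow_of_lt (by linarith) one_pos
    refine h.congr_fun (fun y hy => ?_) measurableSet_Ioi
    have hy' : (1 : ℝ) < y := hy
    have hy0 : 0 < y := one_pos.trans hy'
    simp only
    rw [min_eq_left hy'.le, hpow y hy0, one_mul, ← Real.rpow_add hy0]
    ring_nf

lemma min_one_mul_norm_mul_rpow_eq {d : ℕ} (α : ℝ) {r : ℝ} (hr : 0 < r) (ξ : Fin d → ℝ) :
    min 1 (r * ‖ξ‖) * ‖ξ‖ ^ (-(α + d)) =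
      r ^ (α + d) * (min 1 ‖r • ξ‖ * ‖r • ξ‖ ^ (-(α + d))) := by
  rw [norm_smul, Real.norm_of_nonneg hr.le, Real.mul_rpow hr.le (norm_nonneg _),
    Real.rpow_neg hr.le]
  have := (Real.rpow_pos_of_pos hr (α + d)).ne'
  field_simp

lemma integrable_min_one_mul_norm_mul_rpow {d : ℕ} (hd : 0 < d) {α : ℝ} (hα0 : 0 < α)
    (hα1 : α < 1) {r : ℝ} (hr : 0 < r) :
    Integrable (fun ξ : Fin d → ℝ => min 1 (r * ‖ξ‖) * ‖ξ‖ ^ (-(α + d))) := by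
  simp_rw [min_one_mul_norm_mul_rpow_eq α hr]
  exact ((integrable_min_one_norm_mul_rpow hd hα0 hα1).comp_smul hr.ne').const_mul _

lemma integral_min_one_mul_norm_mul_rpow {d : ℕ} (α : ℝ) {r : ℝ} (hr : 0 < r) :
    ∫ ξ : Fin d → ℝ, min 1 (r * ‖ξ‖) * ‖ξ‖ ^ (-(α + d)) =
      r ^ α * ∫ ξ : Fin d → ℝ, min 1 ‖ξ‖ * ‖ξ‖ ^ (-(α + d)) := by
  simp_rw [min_one_mul_norm_mul_rpow_eq α hr]
  rw [integral_const_mul, Measure.integral_comp_smul volume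
    (fun ξ : Fin d → ℝ => min 1 ‖ξ‖ * ‖ξ‖ ^ (-(α + d))) r, Module.finrank_fintype_fun_eq_card,
    Fintype.card_fin, smul_eq_mul, ← mul_assoc, Real.rpow_add hr, Real.rpow_natCast,
    abs_of_pos (by positivity)]
  have : r ^ d ≠ 0 := by positivity
  field_simp

/-- The Fourier transform of the Bessel potential of order `α + d`. -/
noncomputable def besselWeight (d : ℕ) (α : ℝ) (ξ : Fin d → ℝ) : ℝ :=
  (1 + 4 * Real.pi ^ 2 * (∑ i, ξ i ^ 2)) ^ (-(α + d) / 2)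

lemma besselWeight_nonneg (d : ℕ) (α : ℝ) (ξ : Fin d → ℝ) : 0 ≤ besselWeight d α ξ := by
  have := Finset.sum_nonneg fun i (_ : i ∈ Finset.univ) => sq_nonneg (ξ i)
  exact Real.rpow_nonneg (by positivity) _

lemma besselWeight_le_one_add_norm_sq_rpow (d : ℕ) {α : ℝ} (hα : 0 < α) (ξ : Fin d → ℝ) :
    besselWeight d α ξ ≤ (1 + ‖ξ‖ ^ 2) ^ (-(α + d) / 2) := by
  have hd : (0 : ℝ) ≤ d := d.cast_nonneg
  refine Real.rpow_le_rpow_of_nonpos (by positivity) ?_ (by linarith)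
  have := sq_pi_norm_le_sum_sq ξ
  have : 0 ≤ ∑ i, ξ i ^ 2 := (sq_nonneg _).trans this
  have : 1 ≤ Real.pi ^ 2 := one_le_pow₀ (by linarith [Real.pi_gt_three])
  nlinarith

lemma besselWeight_le_norm_rpow (d : ℕ) {α : ℝ} (hα : 0 < α) {ξ : Fin d → ℝ} (hξ : ξ ≠ 0) :
    besselWeight d α ξ ≤ ‖ξ‖ ^ (-(α + d)) := by
  have hd : (0 : ℝ) ≤ d := d.cast_nonneg
  have h0 : 0 < ‖ξ‖ := norm_pos_iff.2 hξ
  refine (besselWeight_le_one_add_norm_sq_rpow d hα ξ).trans ?_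
  calc (1 + ‖ξ‖ ^ 2) ^ (-(α + d) / 2) ≤ (‖ξ‖ ^ 2) ^ (-(α + d) / 2) :=
        Real.rpow_le_rpow_of_nonpos (by positivity) (by linarith) (by linarith)
    _ = ‖ξ‖ ^ (-(α + d)) := by
        rw [← Real.rpow_natCast, ← Real.rpow_mul h0.le]
        congr 1
        push_cast
        ring

lemma integrable_besselWeight (d : ℕ) {α : ℝ} (hα : 0 < α) : Integrable (besselWeight d α) := by
  have h : Integrable (fun ξ : Fin d → ℝ => (1 + ‖ξ‖ ^ 2) ^ (-(α + d) / 2)) :=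
    integrable_rpow_neg_one_add_norm_sq (by simpa using hα)
  refine h.mono' ?_ (Filter.Eventually.of_forall fun ξ => ?_)
  · unfold besselWeight
    exact Measurable.aestronglyMeasurable (by fun_prop)
  · rw [Real.norm_of_nonneg (besselWeight_nonneg d α ξ)]
    exact besselWeight_le_one_add_norm_sq_rpow d hα ξ

lemma integrable_besselWeight_mul_exp (d : ℕ) {α : ℝ} (hα : 0 < α) (x : Fin d → ℝ) :
    Integrable (fun ξ : Fin d → ℝ => (besselWeight d α ξ : ℂ) *
      Complex.exp (2 * (Real.pi : ℂ) * Complex.I * (dot ξ x : ℝ))) := by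
  refine (integrable_besselWeight d hα).ofReal.mul_bdd (c := 1) ?_
    (Filter.Eventually.of_forall fun ξ => ?_)
  · unfold dot
    exact Continuous.aestronglyMeasurable (by fun_prop)
  · rw [Complex.norm_exp]
    simp

lemma abs_besselPotential_sub_le (d : ℕ) {α : ℝ} (hα : 0 < α) (x y : Fin d → ℝ)
    {g : (Fin d → ℝ) → ℝ} (hg : Integrable g)
    (h : ∀ᵐ ξ, besselWeight d α ξ *
      ‖Complex.exp (2 * (Real.pi : ℂ) * Complex.I * (dot ξ x : ℝ)) -
        Complex.exp (2 * (Real.pi : ℂ) * Complex.I * (dot ξ y : ℝ))‖ ≤ g ξ) :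
    |besselPotential d α x - besselPotential d α y| ≤ ∫ ξ, g ξ := by
  change |(∫ ξ, (besselWeight d α ξ : ℂ) * _).re - (∫ ξ, (besselWeight d α ξ : ℂ) * _).re| ≤ _
  rw [← Complex.sub_re, ← integral_sub (integrable_besselWeight_mul_exp d hα x)
    (integrable_besselWeight_mul_exp d hα y)]
  refine (Complex.abs_re_le_norm _).trans (norm_integral_le_of_norm_le hg ?_)
  filter_upwards [h] with ξ hξ
  rwa [← mul_sub, norm_mul, Complex.norm_real, Real.norm_of_nonneg (besselWeight_nonneg d α ξ)]

/-- The Bessel potential of order `α + d` is `s`-Hölder continuous for `0 < s ≤ α`. -/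
theorem bessel_potential_holder
    (d : ℕ) (hd : 0 < d) (α : ℝ) (hα0 : 0 < α) (hα1 : α < 1)
    (s : ℝ) (hs0 : 0 < s) (hsα : s ≤ α) :
    ∃ C : ℝ, 0 < C ∧ ∀ x y : Fin d → ℝ,
      |besselPotential d α x - besselPotential d α y|
        ≤ C * Real.sqrt (∑ i, (x i - y i) ^ 2) ^ s := by
  have : Nonempty (Fin d) := ⟨⟨0, hd⟩⟩
  set K : ℝ := 2 + 2 * Real.pi * d
  set J : ℝ := ∫ ξ : Fin d → ℝ, min 1 ‖ξ‖ * ‖ξ‖ ^ (-(α + d))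
  set M : ℝ := ∫ ξ, besselWeight d α ξ
  have hK : 0 < K := by positivity
  have hJ : 0 ≤ J := integral_nonneg fun ξ => by positivity
  have hM : 0 ≤ M := integral_nonneg (besselWeight_nonneg d α)
  refine ⟨K * J + K * M + 1, by positivity, fun x y => ?_⟩
  set r := Real.sqrt (∑ i, (x i - y i) ^ 2)
  have hxy : ‖x - y‖ ≤ r := Real.le_sqrt_of_sq_le (sq_pi_norm_le_sum_sq (x - y))
  have hr0 : 0 ≤ r := Real.sqrt_nonneg _
  rcases eq_or_ne x y with rfl | hne
  · simp only [sub_self, abs_zero]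
    positivity
  have hr : 0 < r := (norm_pos_iff.2 (sub_ne_zero.2 hne)).trans_le hxy
  have hrs : 0 < r ^ s := Real.rpow_pos_of_pos hr s
  rcases le_total r 1 with h1 | h1
  · have hbound : |besselPotential d α x - besselPotential d α y| ≤
        ∫ ξ : Fin d → ℝ, K * (min 1 (r * ‖ξ‖) * ‖ξ‖ ^ (-(α + d))) := by
      refine abs_besselPotential_sub_le d hα0 x y
        ((integrable_min_one_mul_norm_mul_rpow hd hα0 hα1 hr).const_mul K) ?_
      filter_upwards [Measure.ae_ne volume (0 : Fin d → ℝ)] with ξ hξ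
      calc _ ≤ ‖ξ‖ ^ (-(α + d)) * (K * min 1 (r * ‖ξ‖)) :=
            mul_le_mul (besselWeight_le_norm_rpow d hα0 hξ)
              (norm_exp_dot_sub_exp_dot_le ξ x y hxy) (norm_nonneg _) (by positivity)
        _ = _ := by ring
    rw [integral_const_mul, integral_min_one_mul_norm_mul_rpow α hr] at hbound
    have hrα : r ^ α ≤ r ^ s := Real.rpow_le_rpow_of_exponent_ge hr h1 hsα
    calc _ ≤ K * (r ^ α * J) := hbound
      _ ≤ K * (r ^ s * J) := by gcongr
      _ ≤ (K * J + K * M + 1) * r ^ s := by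
        have : 0 ≤ K * M * r ^ s := by positivity
        nlinarith
  · have hbound : |besselPotential d α x - besselPotential d α y| ≤
        ∫ ξ, besselWeight d α ξ * K := by
      refine abs_besselPotential_sub_le d hα0 x y ((integrable_besselWeight d hα0).mul_const K)
        (Filter.Eventually.of_forall fun ξ => ?_)
      refine mul_le_mul_of_nonneg_left ?_ (besselWeight_nonneg d α ξ)
      exact (norm_exp_dot_sub_exp_dot_le ξ x y hxy).trans
        (mul_le_of_le_one_right hK.le (min_le_left _ _))
    rw [integral_mul_const] at hbound
    have h1s : 1 ≤ r ^ s := Real.one_le_rpow h1 hs0.le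
    have : 0 ≤ K * J := by positivity
    have : 0 ≤ K * M := by positivity
    calc _ ≤ M * K := hbound
      _ ≤ (K * J + K * M + 1) * 1 := by linarith
      _ ≤ (K * J + K * M + 1) * r ^ s := by gcongr
end

section
/- Let d ∈ ℕ₊, α ∈ (0,1), and let f : ℝ^d → ℝ be the Bessel potential f(x) = ∫_{ℝ^d} (1 + 4π²|ξ|²)^{−(α+d)/2} e^{2πi ξ·x} dξ. Then for every x ∈ ℝ^d with 0 < |x| < 1, one has f(0) − f(x) ≥ [Γ((α+1)/2) / (2^{d−1} α π^{(d+1)/2+α} Γ((α+d)/2))] · |x|^α, where |x| is the Euclidean norm and Γ is the Gamma function. In particular f ∉ C^s(ℝ^d) for every s > α. -/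
open MeasureTheory

lemma gaussian_mul_cos_eq_re {d : ℕ} (b : ℝ) (ξ x : Fin d → ℝ) :
    Real.exp (-b * ∑ i, ξ i ^ 2) * Real.cos (2 * Real.pi * dot ξ x) =
      (Complex.exp (-(b : ℂ) * ∑ i, (ξ i : ℂ) ^ 2 +
        ∑ i, (2 * Real.pi * Complex.I * x i) * ξ i)).re := by
  have h : (-(b : ℂ) * ∑ i, (ξ i : ℂ) ^ 2 + ∑ i, (2 * Real.pi * Complex.I * x i) * ξ i) =
      ((-b * ∑ i, ξ i ^ 2 : ℝ) : ℂ) + ((2 * Real.pi * dot ξ x : ℝ) : ℂ) * Complex.I := by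
    simp only [dot]
    push_cast
    rw [Finset.mul_sum Finset.univ (fun i => (ξ i : ℂ) * x i), Finset.sum_mul]
    congr 1
    exact Finset.sum_congr rfl fun i _ => by ring
  rw [h, Complex.exp_add, ← Complex.ofReal_exp, Complex.re_ofReal_mul,
    Complex.exp_ofReal_mul_I_re]

lemma integrable_gaussian_mul_cos {d : ℕ} {b : ℝ} (hb : 0 < b) (x : Fin d → ℝ) :
    Integrable fun ξ : Fin d → ℝ =>
      Real.exp (-b * ∑ i, ξ i ^ 2) * Real.cos (2 * Real.pi * dot ξ x) := by
  simp only [gaussian_mul_cos_eq_re]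
  exact (GaussianFourier.integrable_cexp_neg_mul_sum_add (b := (b : ℂ)) (by simpa using hb)
    fun i => 2 * Real.pi * Complex.I * x i).re

lemma integral_gaussian_mul_cos {d : ℕ} {b : ℝ} (hb : 0 < b) (x : Fin d → ℝ) :
    ∫ ξ : Fin d → ℝ, Real.exp (-b * ∑ i, ξ i ^ 2) * Real.cos (2 * Real.pi * dot ξ x) =
      (Real.pi / b) ^ ((d : ℝ) / 2) * Real.exp (-Real.pi ^ 2 * (∑ i, x i ^ 2) / b) := by
  simp only [gaussian_mul_cos_eq_re]
  have hint := GaussianFourier.integrable_cexp_neg_mul_sum_add (b := (b : ℂ)) (by simpa using hb)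
    fun i : Fin d => 2 * Real.pi * Complex.I * x i
  have hval := GaussianFourier.integral_cexp_neg_mul_sum_add (b := (b : ℂ)) (by simpa using hb)
    fun i : Fin d => 2 * Real.pi * Complex.I * x i
  rw [show (∫ ξ : Fin d → ℝ, (Complex.exp (-(b : ℂ) * ∑ i, (ξ i : ℂ) ^ 2 +
        ∑ i, (2 * Real.pi * Complex.I * x i) * ξ i)).re) = _ from integral_re hint, hval]
  have hpb : 0 ≤ Real.pi / b := by positivity
  have h1 : (((Real.pi : ℂ) / b) ^ ((Fintype.card (Fin d) : ℂ) / 2)) =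
      (((Real.pi / b) ^ ((d : ℝ) / 2) : ℝ) : ℂ) := by
    rw [Complex.ofReal_cpow hpb]
    simp
  have h2 : (∑ i, (2 * Real.pi * Complex.I * (x i : ℂ)) ^ 2) / (4 * (b : ℂ)) =
      ((-Real.pi ^ 2 * (∑ i, x i ^ 2) / b : ℝ) : ℂ) := by
    simp only [mul_pow, Complex.I_sq, ← Finset.mul_sum]
    push_cast
    have : (b : ℂ) ≠ 0 := by exact_mod_cast hb.ne'
    field_simp
    ring
  rw [h1, h2, ← Complex.ofReal_exp, ← Complex.ofReal_mul]
  exact Complex.ofReal_re _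

lemma integrable_gaussian_mul_one_sub_cos {d : ℕ} {b : ℝ} (hb : 0 < b) (x : Fin d → ℝ) :
    Integrable fun ξ : Fin d → ℝ =>
      Real.exp (-b * ∑ i, ξ i ^ 2) * (1 - Real.cos (2 * Real.pi * dot ξ x)) := by
  have h := (integrable_gaussian_mul_cos hb (0 : Fin d → ℝ)).sub (integrable_gaussian_mul_cos hb x)
  refine h.congr (.of_forall fun ξ => ?_)
  simp [dot, mul_sub]

lemma integral_gaussian_mul_one_sub_cos {d : ℕ} {b : ℝ} (hb : 0 < b) (x : Fin d → ℝ) :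
    ∫ ξ : Fin d → ℝ, Real.exp (-b * ∑ i, ξ i ^ 2) * (1 - Real.cos (2 * Real.pi * dot ξ x)) =
      (Real.pi / b) ^ ((d : ℝ) / 2) * (1 - Real.exp (-Real.pi ^ 2 * (∑ i, x i ^ 2) / b)) := by
  have h0 := integral_gaussian_mul_cos hb (0 : Fin d → ℝ)
  have hx := integral_gaussian_mul_cos hb x
  have h := integral_sub (integrable_gaussian_mul_cos hb (0 : Fin d → ℝ))
    (integrable_gaussian_mul_cos hb x)
  rw [h0, hx] at h
  simpa [dot, mul_sub] using h

lemma integrable_bessel_weight (d : ℕ) {α : ℝ} (hα : 0 < α) :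
    Integrable fun ξ : Fin d → ℝ =>
      (1 + 4 * Real.pi ^ 2 * ∑ i, ξ i ^ 2) ^ (-(α + d) / 2) := by
  have h := integrable_rpow_neg_one_add_norm_sq (E := Fin d → ℝ) (μ := volume) (r := α + d)
    (by simpa using hα)
  refine h.mono' (Measurable.aestronglyMeasurable (by fun_prop)) (.of_forall fun ξ => ?_)
  have hS : 0 ≤ ∑ i, ξ i ^ 2 := Finset.sum_nonneg fun i _ => sq_nonneg _
  rw [Real.norm_of_nonneg (by positivity)]
  refine Real.rpow_le_rpow_of_nonpos (by positivity) ?_ (by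
    have : (0 : ℝ) ≤ d := d.cast_nonneg
    linarith)
  have h1 : ‖ξ‖ ^ 2 ≤ ∑ i, ξ i ^ 2 := by
    have : ‖ξ‖ ≤ Real.sqrt (∑ i, ξ i ^ 2) := by
      refine (pi_norm_le_iff_of_nonneg (Real.sqrt_nonneg _)).2 fun i => ?_
      rw [Real.norm_eq_abs]
      exact Real.abs_le_sqrt
        (Finset.single_le_sum (f := fun i => ξ i ^ 2) (fun i _ => sq_nonneg _) (Finset.mem_univ i))
    calc ‖ξ‖ ^ 2 ≤ Real.sqrt (∑ i, ξ i ^ 2) ^ 2 := by gcongr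
      _ = _ := Real.sq_sqrt hS
  have h2 : 1 ≤ 4 * Real.pi ^ 2 := by nlinarith [Real.pi_gt_three]
  nlinarith

lemma measurable_dot_left {d : ℕ} (x : Fin d → ℝ) : Measurable fun ξ : Fin d → ℝ => dot ξ x := by
  unfold dot
  fun_prop

lemma integrable_bessel_weight_mul_one_sub_cos {d : ℕ} {α : ℝ} (hα : 0 < α) (x : Fin d → ℝ) :
    Integrable fun ξ : Fin d → ℝ =>
      (1 + 4 * Real.pi ^ 2 * ∑ i, ξ i ^ 2) ^ (-(α + d) / 2) *
        (1 - Real.cos (2 * Real.pi * dot ξ x)) := by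
  refine (integrable_bessel_weight d hα).mul_bdd (c := 2)
    (Measurable.aestronglyMeasurable ?_) (.of_forall fun ξ => ?_)
  · have := measurable_dot_left x
    fun_prop
  · rw [Real.norm_eq_abs, abs_le]
    constructor <;> linarith [Real.cos_le_one (2 * Real.pi * dot ξ x),
      Real.neg_one_le_cos (2 * Real.pi * dot ξ x)]

lemma besselPotential_eq_integral_cos {d : ℕ} {α : ℝ} (hα : 0 < α) (x : Fin d → ℝ) :
    Integrable (fun ξ : Fin d → ℝ => (1 + 4 * Real.pi ^ 2 * ∑ i, ξ i ^ 2) ^ (-(α + d) / 2) *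
        Real.cos (2 * Real.pi * dot ξ x)) ∧
    besselPotential d α x = ∫ ξ : Fin d → ℝ,
      (1 + 4 * Real.pi ^ 2 * ∑ i, ξ i ^ 2) ^ (-(α + d) / 2) *
        Real.cos (2 * Real.pi * dot ξ x) := by
  have hint : Integrable fun ξ : Fin d → ℝ =>
      (((1 + 4 * Real.pi ^ 2 * (∑ i, ξ i ^ 2)) ^ (-(α + d) / 2) : ℝ) : ℂ) *
        Complex.exp (2 * (Real.pi : ℂ) * Complex.I * (dot ξ x : ℝ)) := by
    refine (integrable_bessel_weight d hα).ofReal.mul_bdd (c := 1)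
      (Measurable.aestronglyMeasurable ?_) (.of_forall fun ξ => ?_)
    · have := measurable_dot_left x
      fun_prop
    · rw [show 2 * (Real.pi : ℂ) * Complex.I * (dot ξ x : ℝ) =
        ((2 * Real.pi * dot ξ x : ℝ) : ℂ) * Complex.I by push_cast; ring,
        Complex.norm_exp_ofReal_mul_I]
  have hre : ∀ ξ : Fin d → ℝ,
      ((((1 + 4 * Real.pi ^ 2 * (∑ i, ξ i ^ 2)) ^ (-(α + d) / 2) : ℝ) : ℂ) *
        Complex.exp (2 * (Real.pi : ℂ) * Complex.I * (dot ξ x : ℝ))).re =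
      (1 + 4 * Real.pi ^ 2 * ∑ i, ξ i ^ 2) ^ (-(α + d) / 2) *
        Real.cos (2 * Real.pi * dot ξ x) := fun ξ => by
    rw [Complex.re_ofReal_mul, show 2 * (Real.pi : ℂ) * Complex.I * (dot ξ x : ℝ) =
        ((2 * Real.pi * dot ξ x : ℝ) : ℂ) * Complex.I by push_cast; ring,
      Complex.exp_ofReal_mul_I_re]
  refine ⟨hint.re.congr (.of_forall hre), ?_⟩
  unfold besselPotential
  exact (integral_re hint).symm.trans (integral_congr_ae (.of_forall hre))

lemma besselPotential_zero_sub {d : ℕ} {α : ℝ} (hα : 0 < α) (x : Fin d → ℝ) :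
    besselPotential d α 0 - besselPotential d α x = ∫ ξ : Fin d → ℝ,
      (1 + 4 * Real.pi ^ 2 * ∑ i, ξ i ^ 2) ^ (-(α + d) / 2) *
        (1 - Real.cos (2 * Real.pi * dot ξ x)) := by
  obtain ⟨i0, h0⟩ := besselPotential_eq_integral_cos hα (0 : Fin d → ℝ)
  obtain ⟨ix, hx⟩ := besselPotential_eq_integral_cos hα x
  rw [h0, hx, ← integral_sub i0 ix]
  simp [dot, mul_sub]

lemma Gamma_mul_rpow_neg_eq_lintegral {s A : ℝ} (hs : 0 < s) (hA : 0 < A) :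
    ENNReal.ofReal (Real.Gamma s * A ^ (-s)) =
      ∫⁻ t in Set.Ioi (0 : ℝ), ENNReal.ofReal (t ^ (s - 1) * Real.exp (-(A * t))) := by
  have h := Real.integral_rpow_mul_exp_neg_mul_Ioi hs hA
  have hpos : 0 < (1 / A) ^ s * Real.Gamma s := by
    have := Real.Gamma_pos_of_pos hs
    positivity
  rw [← ofReal_integral_eq_lintegral_ofReal, h]
  · rw [one_div, Real.inv_rpow hA.le, Real.rpow_neg hA.le, mul_comm]
  · exact Integrable.of_integral_ne_zero (by rw [h]; exact hpos.ne')
  · refine (ae_restrict_iff' measurableSet_Ioi).2 (.of_forall fun t ht => ?_)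
    have : (0 : ℝ) < t := ht
    positivity

/-- The Gamma subordination formula, which reduces the difference `f 0 - f x` to an integral
depending on the dimension only through a multiplicative constant. -/
lemma ofReal_besselPotential_zero_sub {d : ℕ} {α : ℝ} (hα : 0 < α) (x : Fin d → ℝ) :
    ENNReal.ofReal (Real.Gamma ((α + d) / 2) * (4 * Real.pi) ^ ((d : ℝ) / 2) *
      (besselPotential d α 0 - besselPotential d α x)) =
    ∫⁻ t in Set.Ioi (0 : ℝ), ENNReal.ofReal (t ^ (α / 2 - 1) * Real.exp (-t) *
      (1 - Real.exp (-(∑ i, x i ^ 2) / (4 * t)))) := by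
  have hs : 0 < (α + d) / 2 := by positivity
  have hcos : ∀ ξ : Fin d → ℝ, 0 ≤ 1 - Real.cos (2 * Real.pi * dot ξ x) := fun ξ =>
    sub_nonneg.2 (Real.cos_le_one _)
  have hS : ∀ ξ : Fin d → ℝ, 0 ≤ ∑ i, ξ i ^ 2 := fun ξ => Finset.sum_nonneg fun i _ => sq_nonneg _
  have hG := Real.Gamma_pos_of_pos hs
  have hmeas := measurable_dot_left x
  calc _ = ENNReal.ofReal ((4 * Real.pi) ^ ((d : ℝ) / 2)) * ∫⁻ ξ : Fin d → ℝ, ENNReal.ofReal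
        (Real.Gamma ((α + d) / 2) * ((1 + 4 * Real.pi ^ 2 * ∑ i, ξ i ^ 2) ^ (-(α + d) / 2) *
          (1 - Real.cos (2 * Real.pi * dot ξ x)))) := by
        rw [← ofReal_integral_eq_lintegral_ofReal
            ((integrable_bessel_weight_mul_one_sub_cos hα x).const_mul _)
            (.of_forall fun ξ => by have := hcos ξ; have := hS ξ; positivity),
          ← ENNReal.ofReal_mul (by positivity), integral_const_mul, besselPotential_zero_sub hα]
        ring_nf
    _ = ENNReal.ofReal ((4 * Real.pi) ^ ((d : ℝ) / 2)) * ∫⁻ ξ : Fin d → ℝ,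
        ∫⁻ t in Set.Ioi (0 : ℝ), ENNReal.ofReal (t ^ ((α + d) / 2 - 1) *
          Real.exp (-((1 + 4 * Real.pi ^ 2 * ∑ i, ξ i ^ 2) * t)) *
            (1 - Real.cos (2 * Real.pi * dot ξ x))) := by
        congr 1
        refine lintegral_congr fun ξ => ?_
        have hA : 0 < 1 + 4 * Real.pi ^ 2 * ∑ i, ξ i ^ 2 := by have := hS ξ; positivity
        rw [← mul_assoc, ENNReal.ofReal_mul' (hcos ξ), neg_div,
          Gamma_mul_rpow_neg_eq_lintegral hs hA, ← lintegral_mul_const' _ _ ENNReal.ofReal_ne_top]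
        simp_rw [ENNReal.ofReal_mul' (hcos ξ)]
    _ = ENNReal.ofReal ((4 * Real.pi) ^ ((d : ℝ) / 2)) * ∫⁻ t in Set.Ioi (0 : ℝ),
        ∫⁻ ξ : Fin d → ℝ, ENNReal.ofReal (t ^ ((α + d) / 2 - 1) *
          Real.exp (-((1 + 4 * Real.pi ^ 2 * ∑ i, ξ i ^ 2) * t)) *
            (1 - Real.cos (2 * Real.pi * dot ξ x))) := by
        rw [lintegral_lintegral_swap]
        refine Measurable.aemeasurable ?_
        have : Measurable fun p : (Fin d → ℝ) × ℝ => dot p.1 x := hmeas.comp measurable_fst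
        unfold Function.uncurry
        fun_prop
    _ = _ := by
        rw [← lintegral_const_mul' _ _ ENNReal.ofReal_ne_top]
        refine setLIntegral_congr_fun measurableSet_Ioi fun t ht => ?_
        have ht : 0 < t := ht
        have hb : 0 < 4 * Real.pi ^ 2 * t := by positivity
        have hfun : ∀ ξ : Fin d → ℝ, t ^ ((α + d) / 2 - 1) *
          Real.exp (-((1 + 4 * Real.pi ^ 2 * ∑ i, ξ i ^ 2) * t)) *
            (1 - Real.cos (2 * Real.pi * dot ξ x)) = t ^ ((α + d) / 2 - 1) * Real.exp (-t) *
            (Real.exp (-(4 * Real.pi ^ 2 * t) * ∑ i, ξ i ^ 2) *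
              (1 - Real.cos (2 * Real.pi * dot ξ x))) := fun ξ => by
          rw [show -((1 + 4 * Real.pi ^ 2 * ∑ i, ξ i ^ 2) * t) =
            -t + -(4 * Real.pi ^ 2 * t) * ∑ i, ξ i ^ 2 by ring, Real.exp_add]
          ring
        simp_rw [hfun]
        rw [← ofReal_integral_eq_lintegral_ofReal
            ((integrable_gaussian_mul_one_sub_cos hb x).const_mul _)
            (.of_forall fun ξ => by have := hcos ξ; positivity),
          ← ENNReal.ofReal_mul (by positivity), integral_const_mul,
          integral_gaussian_mul_one_sub_cos hb x]
        congr 1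
        have e1 : Real.pi / (4 * Real.pi ^ 2 * t) = (4 * Real.pi * t)⁻¹ := by
          field_simp
        have e2 : -Real.pi ^ 2 * (∑ i, x i ^ 2) / (4 * Real.pi ^ 2 * t) =
            -(∑ i, x i ^ 2) / (4 * t) := by
          field_simp
        rw [e1, e2, Real.inv_rpow (by positivity), Real.mul_rpow (by positivity) ht.le,
          show (α + d) / 2 - 1 = (α / 2 - 1) + (d : ℝ) / 2 by ring, Real.rpow_add ht]
        field_simp

lemma besselPotential_zero_sub_eq_one_dim {d : ℕ} {α : ℝ} (hα : 0 < α) (x : Fin d → ℝ) :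
    Real.Gamma ((α + d) / 2) * (4 * Real.pi) ^ ((d : ℝ) / 2) *
      (besselPotential d α 0 - besselPotential d α x) =
    Real.Gamma ((α + 1) / 2) * (4 * Real.pi) ^ ((1 : ℝ) / 2) *
      (besselPotential 1 α 0 - besselPotential 1 α fun _ => Real.sqrt (∑ i, x i ^ 2)) := by
  have hnn : ∀ {n : ℕ} (y : Fin n → ℝ), 0 ≤ Real.Gamma ((α + n) / 2) *
      (4 * Real.pi) ^ ((n : ℝ) / 2) * (besselPotential n α 0 - besselPotential n α y) := by
    intro n y
    have hG : 0 < Real.Gamma ((α + n) / 2) := Real.Gamma_pos_of_pos (by positivity)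
    refine mul_nonneg (by positivity) ?_
    rw [besselPotential_zero_sub hα]
    refine integral_nonneg fun ξ => mul_nonneg ?_ (sub_nonneg.2 (Real.cos_le_one _))
    have : 0 ≤ ∑ i, ξ i ^ 2 := Finset.sum_nonneg fun i _ => sq_nonneg _
    positivity
  have h1 := ofReal_besselPotential_zero_sub hα (fun _ : Fin 1 => Real.sqrt (∑ i, x i ^ 2))
  have hd := ofReal_besselPotential_zero_sub hα x
  have hS : 0 ≤ ∑ i, x i ^ 2 := Finset.sum_nonneg fun i _ => sq_nonneg _
  simp only [Finset.univ_unique, Finset.sum_const, Finset.card_singleton, one_smul,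
    Real.sq_sqrt hS] at h1
  have := (ENNReal.ofReal_eq_ofReal_iff (hnn x) (hnn _)).1 (hd.trans h1.symm)
  simpa using this

lemma besselPotential_one_dim_zero_sub {α : ℝ} (hα : 0 < α) (r : ℝ) :
    IntegrableOn (fun t => (1 + 4 * Real.pi ^ 2 * t ^ 2) ^ (-(α + 1) / 2) *
      (1 - Real.cos (2 * Real.pi * r * t))) (Set.Ioi (0 : ℝ)) ∧
    besselPotential 1 α 0 - besselPotential 1 α (fun _ => r) =
      2 * ∫ t in Set.Ioi (0 : ℝ), (1 + 4 * Real.pi ^ 2 * t ^ 2) ^ (-(α + 1) / 2) *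
        (1 - Real.cos (2 * Real.pi * r * t)) := by
  have hmp : MeasurePreserving (MeasurableEquiv.funUnique (Fin 1) ℝ) volume volume := by
    convert! volume_preserving_funUnique (Fin 1) ℝ
  have hemb := (MeasurableEquiv.funUnique (Fin 1) ℝ).measurableEmbedding
  set g : ℝ → ℝ := fun t => (1 + 4 * Real.pi ^ 2 * t ^ 2) ^ (-(α + 1) / 2) *
    (1 - Real.cos (2 * Real.pi * r * t)) with hg
  have hfun : ∀ ξ : Fin 1 → ℝ, (1 + 4 * Real.pi ^ 2 * ∑ i, ξ i ^ 2) ^ (-(α + (1 : ℕ)) / 2) *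
      (1 - Real.cos (2 * Real.pi * dot ξ fun _ => r)) =
        g (MeasurableEquiv.funUnique (Fin 1) ℝ ξ) := by
    intro ξ
    have : 2 * Real.pi * dot ξ (fun _ => r) = 2 * Real.pi * r * ξ 0 := by
      simp [dot]
      ring
    rw [this]
    simp [hg]
  constructor
  · have h := integrable_bessel_weight_mul_one_sub_cos hα (fun _ : Fin 1 => r)
    simp_rw [hfun] at h
    exact ((hmp.integrable_comp_emb hemb (g := g)).1 h).integrableOn
  · rw [besselPotential_zero_sub hα]
    simp_rw [hfun]
    rw [hmp.integral_comp hemb g, ← integral_comp_abs]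
    refine integral_congr_ae (.of_forall fun t => ?_)
    have : Real.cos (2 * Real.pi * r * |t|) = Real.cos (2 * Real.pi * r * t) := by
      rcases abs_cases t with ⟨h, -⟩ | ⟨h, -⟩ <;> simp [h]
    simp only [hg, sq_abs, this]

lemma sub_le_intervalIntegral_one_sub_cos {α r R : ℝ} (hα : 0 < α) (hr0 : 0 < r) (hr1 : r < 1)
    (hR : 1 / (4 * r) ≤ R) :
    r ^ α * (1 + Real.pi / 2) ^ (-α) / (2 * Real.pi * α) -
        (1 / r + 2 * Real.pi * R) ^ (-α) / (2 * Real.pi * α) ≤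
      ∫ t in (1 / (4 * r))..R, (1 + 4 * Real.pi ^ 2 * t ^ 2) ^ (-(α + 1) / 2) *
        (1 - Real.cos (2 * Real.pi * r * t)) := by
  have hπ := Real.pi_pos
  have ha : 0 < 1 / (4 * r) := by positivity
  set G : ℝ → ℝ := fun t => (1 - Real.sin (2 * Real.pi * r * t)) *
    (1 + 4 * Real.pi ^ 2 * t ^ 2) ^ (-(α + 1) / 2) / (2 * Real.pi * r) -
      (1 / r + 2 * Real.pi * t) ^ (-α) / (2 * Real.pi * α) with hG
  have hderiv : ∀ t : ℝ, 0 < t → HasDerivAt G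
      ((-(Real.cos (2 * Real.pi * r * t) * (2 * Real.pi * r)) *
          (1 + 4 * Real.pi ^ 2 * t ^ 2) ^ (-(α + 1) / 2) +
        (1 - Real.sin (2 * Real.pi * r * t)) * ((4 * Real.pi ^ 2 * (2 * t)) * (-(α + 1) / 2) *
          (1 + 4 * Real.pi ^ 2 * t ^ 2) ^ (-(α + 1) / 2 - 1))) / (2 * Real.pi * r) -
      (2 * Real.pi) * (-α) * (1 / r + 2 * Real.pi * t) ^ (-α - 1) / (2 * Real.pi * α)) t := by
    intro t ht
    have h1 : HasDerivAt (fun t => 2 * Real.pi * r * t) (2 * Real.pi * r) t := by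
      simpa using (hasDerivAt_id t).const_mul (2 * Real.pi * r)
    have h2 : HasDerivAt (fun t => 1 + 4 * Real.pi ^ 2 * t ^ 2) (4 * Real.pi ^ 2 * (2 * t)) t := by
      simpa using ((hasDerivAt_pow 2 t).const_mul (4 * Real.pi ^ 2)).const_add 1
    have h3 : HasDerivAt (fun t => 1 / r + 2 * Real.pi * t) (2 * Real.pi) t := by
      simpa using ((hasDerivAt_id t).const_mul (2 * Real.pi)).const_add (1 / r)
    exact (((h1.sin.const_sub 1).mul
      (h2.rpow_const (p := -(α + 1) / 2) (Or.inl (by positivity)))).div_const _).sub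
      ((h3.rpow_const (p := -α) (Or.inl (by positivity))).div_const _)
  have hcont : ContinuousOn G (Set.Icc (1 / (4 * r)) R) := fun t ht =>
    (hderiv t (ha.trans_le ht.1)).continuousAt.continuousWithinAt
  have hφ : Continuous fun t : ℝ => (1 + 4 * Real.pi ^ 2 * t ^ 2) ^ (-(α + 1) / 2) *
      (1 - Real.cos (2 * Real.pi * r * t)) :=
    (Continuous.rpow_const (by fun_prop) fun t => Or.inl (by positivity)).mul (by fun_prop)
  have hmain := intervalIntegral.sub_le_integral_of_hasDeriv_right_of_le hR hcont
    (fun t ht => (hderiv t (ha.trans ht.1)).hasDerivWithinAt)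
    (hφ.continuousOn.integrableOn_Icc) (fun t ht => by
      have ht0 : 0 < t := ha.trans ht.1
      have hsin : 0 ≤ 1 - Real.sin (2 * Real.pi * r * t) := sub_nonneg.2 (Real.sin_le_one _)
      have hpow : (1 / r + 2 * Real.pi * t) ^ (-α - 1) ≤
          (1 + 4 * Real.pi ^ 2 * t ^ 2) ^ (-(α + 1) / 2) := by
        have h1r : 1 ≤ 1 / r := (one_le_div hr0).2 hr1.le
        have hsq : (1 / r + 2 * Real.pi * t) ^ (-α - 1) =
            ((1 / r + 2 * Real.pi * t) ^ 2) ^ (-(α + 1) / 2) := by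
          rw [← Real.rpow_natCast, ← Real.rpow_mul (by positivity)]
          congr 1
          push_cast
          ring
        rw [hsq]
        refine Real.rpow_le_rpow_of_nonpos (by positivity) ?_ (by linarith)
        have : 0 ≤ 1 / r * (2 * Real.pi * t) := by positivity
        nlinarith
      have hw : 0 ≤ (1 + 4 * Real.pi ^ 2 * t ^ 2) ^ (-(α + 1) / 2 - 1) := by positivity
      have hterm : 0 ≤ (1 - Real.sin (2 * Real.pi * r * t)) * ((4 * Real.pi ^ 2 * (2 * t)) *
          ((α + 1) / 2) * (1 + 4 * Real.pi ^ 2 * t ^ 2) ^ (-(α + 1) / 2 - 1)) /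
            (2 * Real.pi * r) := by positivity
      have e1 : (2 * Real.pi) * (-α) * (1 / r + 2 * Real.pi * t) ^ (-α - 1) / (2 * Real.pi * α) =
          -(1 / r + 2 * Real.pi * t) ^ (-α - 1) := by
        field_simp
      have e2 : (-(Real.cos (2 * Real.pi * r * t) * (2 * Real.pi * r)) *
          (1 + 4 * Real.pi ^ 2 * t ^ 2) ^ (-(α + 1) / 2) +
        (1 - Real.sin (2 * Real.pi * r * t)) * ((4 * Real.pi ^ 2 * (2 * t)) * (-(α + 1) / 2) *
          (1 + 4 * Real.pi ^ 2 * t ^ 2) ^ (-(α + 1) / 2 - 1))) / (2 * Real.pi * r) =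
          -(Real.cos (2 * Real.pi * r * t) * (1 + 4 * Real.pi ^ 2 * t ^ 2) ^ (-(α + 1) / 2)) -
          (1 - Real.sin (2 * Real.pi * r * t)) * ((4 * Real.pi ^ 2 * (2 * t)) *
          ((α + 1) / 2) * (1 + 4 * Real.pi ^ 2 * t ^ 2) ^ (-(α + 1) / 2 - 1)) /
            (2 * Real.pi * r) := by
        field_simp
        ring
      rw [e1, e2]
      linarith)
  refine le_trans ?_ hmain
  have hGR : -((1 / r + 2 * Real.pi * R) ^ (-α) / (2 * Real.pi * α)) ≤ G R := by
    have hsin : 0 ≤ 1 - Real.sin (2 * Real.pi * r * R) := sub_nonneg.2 (Real.sin_le_one _)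
    have : 0 ≤ (1 - Real.sin (2 * Real.pi * r * R)) *
      (1 + 4 * Real.pi ^ 2 * R ^ 2) ^ (-(α + 1) / 2) / (2 * Real.pi * r) := by positivity
    simp only [hG]
    linarith
  have hGa : G (1 / (4 * r)) = -(r ^ α * (1 + Real.pi / 2) ^ (-α) / (2 * Real.pi * α)) := by
    have h1 : 2 * Real.pi * r * (1 / (4 * r)) = Real.pi / 2 := by
      field_simp
      ring
    have h2 : 1 / r + 2 * Real.pi * (1 / (4 * r)) = r⁻¹ * (1 + Real.pi / 2) := by
      field_simp
      ring
    simp only [hG]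
    rw [h1, h2, Real.sin_pi_div_two, Real.mul_rpow (by positivity) (by positivity),
      Real.inv_rpow hr0.le, Real.rpow_neg hr0.le, inv_inv]
    ring
  rw [hGa]
  linarith

lemma le_integral_one_sub_cos {α r : ℝ} (hα : 0 < α) (hr0 : 0 < r) (hr1 : r < 1) :
    r ^ α / (2 * Real.pi ^ (1 + α) * α) ≤
      ∫ t in Set.Ioi (0 : ℝ), (1 + 4 * Real.pi ^ 2 * t ^ 2) ^ (-(α + 1) / 2) *
        (1 - Real.cos (2 * Real.pi * r * t)) := by
  have hπ := Real.pi_pos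
  have hint := (besselPotential_one_dim_zero_sub hα r).1
  have hbound : r ^ α * (1 + Real.pi / 2) ^ (-α) / (2 * Real.pi * α) ≤
      ∫ t in Set.Ioi (0 : ℝ), (1 + 4 * Real.pi ^ 2 * t ^ 2) ^ (-(α + 1) / 2) *
        (1 - Real.cos (2 * Real.pi * r * t)) := by
    have hlim : Filter.Tendsto (fun R : ℝ =>
        r ^ α * (1 + Real.pi / 2) ^ (-α) / (2 * Real.pi * α) -
          (1 / r + 2 * Real.pi * R) ^ (-α) / (2 * Real.pi * α)) Filter.atTop
        (nhds (r ^ α * (1 + Real.pi / 2) ^ (-α) / (2 * Real.pi * α))) := by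
      have h1 : Filter.Tendsto (fun R : ℝ => 1 / r + 2 * Real.pi * R) Filter.atTop Filter.atTop :=
        Filter.tendsto_atTop_add_const_left _ _
          (Filter.tendsto_id.const_mul_atTop (by positivity : 0 < 2 * Real.pi))
      have h2 := ((tendsto_rpow_neg_atTop hα).comp h1).div_const (2 * Real.pi * α)
      simpa using h2.const_sub (r ^ α * (1 + Real.pi / 2) ^ (-α) / (2 * Real.pi * α))
    refine le_of_tendsto hlim ((Filter.eventually_ge_atTop (1 / (4 * r))).mono fun R hR => ?_)
    refine (sub_le_intervalIntegral_one_sub_cos hα hr0 hr1 hR).trans ?_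
    rw [intervalIntegral.integral_of_le hR]
    refine setIntegral_mono_set hint (.of_forall fun t => ?_) (.of_forall fun t ht => ?_)
    · exact mul_nonneg (by positivity) (sub_nonneg.2 (Real.cos_le_one _))
    · exact (by positivity : (0 : ℝ) < 1 / (4 * r)).trans ht.1
  refine le_trans ?_ hbound
  have hmono : Real.pi ^ (-α) ≤ (1 + Real.pi / 2) ^ (-α) :=
    Real.rpow_le_rpow_of_nonpos (by positivity) (by linarith [Real.pi_gt_three]) (by linarith)
  calc r ^ α / (2 * Real.pi ^ (1 + α) * α) = r ^ α * Real.pi ^ (-α) / (2 * Real.pi * α) := by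
        rw [Real.rpow_add hπ, Real.rpow_one, Real.rpow_neg hπ.le]
        field_simp
    _ ≤ _ := by gcongr

/-- The lower bound for the increments of the Bessel potential at the origin. -/
lemma le_besselPotential_zero_sub {d : ℕ} {α : ℝ} (hα : 0 < α) (x : Fin d → ℝ)
    (hx0 : 0 < Real.sqrt (∑ i, x i ^ 2)) (hx1 : Real.sqrt (∑ i, x i ^ 2) < 1) :
    Real.Gamma ((α + 1) / 2) /
        (2 ^ (d - 1 : ℤ) * α * Real.pi ^ (((d : ℝ) + 1) / 2 + α) * Real.Gamma ((α + d) / 2)) *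
        Real.sqrt (∑ i, x i ^ 2) ^ α ≤
      besselPotential d α 0 - besselPotential d α x := by
  set r := Real.sqrt (∑ i, x i ^ 2)
  have hπ := Real.pi_pos
  have hG1 : 0 < Real.Gamma ((α + 1) / 2) := Real.Gamma_pos_of_pos (by positivity)
  have hGd : 0 < Real.Gamma ((α + d) / 2) := Real.Gamma_pos_of_pos (by positivity)
  have hdim := besselPotential_zero_sub_eq_one_dim hα x
  have h1 : r ^ α / (Real.pi ^ (1 + α) * α) ≤
      besselPotential 1 α 0 - besselPotential 1 α (fun _ => r) := by
    rw [(besselPotential_one_dim_zero_sub hα r).2]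
    calc r ^ α / (Real.pi ^ (1 + α) * α) = 2 * (r ^ α / (2 * Real.pi ^ (1 + α) * α)) := by
          field_simp
      _ ≤ _ := by gcongr; exact le_integral_one_sub_cos hα hx0 hx1
  have h4 : ∀ y : ℝ, (4 * Real.pi) ^ (y / 2) = 2 ^ y * Real.pi ^ (y / 2) := fun y => by
    rw [Real.mul_rpow (by norm_num) hπ.le, show (4 : ℝ) = 2 ^ (2 : ℝ) by norm_num,
      ← Real.rpow_mul (by norm_num)]
    ring_nf
  have hz : (2 : ℝ) ^ (d - 1 : ℤ) = 2 ^ (d : ℝ) / 2 := by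
    rw [zpow_sub_one₀ two_ne_zero, zpow_natCast, Real.rpow_natCast]
    rfl
  have hp : Real.pi ^ (((d : ℝ) + 1) / 2 + α) * Real.pi ^ ((1 : ℝ) / 2) =
      Real.pi ^ ((d : ℝ) / 2) * Real.pi ^ (1 + α) := by
    rw [← Real.rpow_add hπ, ← Real.rpow_add hπ]
    ring_nf
  have hC : 0 < Real.Gamma ((α + d) / 2) * (4 * Real.pi) ^ ((d : ℝ) / 2) := by positivity
  refine le_of_mul_le_mul_left ?_ hC
  rw [hdim]
  refine le_trans (le_of_eq ?_) (mul_le_mul_of_nonneg_left h1 (by positivity))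
  rw [h4, h4, hz, Real.rpow_one]
  have hP : 0 < Real.pi ^ (((d : ℝ) + 1) / 2 + α) := by positivity
  have hQ : 0 < Real.pi ^ (1 + α) := by positivity
  have h2d : (0 : ℝ) < 2 ^ (d : ℝ) := by positivity
  generalize Real.pi ^ (((d : ℝ) + 1) / 2 + α) = P at *
  generalize Real.pi ^ (1 + α) = Q at *
  generalize Real.pi ^ ((1 : ℝ) / 2) = S at *
  generalize Real.pi ^ ((d : ℝ) / 2) = T at *
  generalize (2 : ℝ) ^ (d : ℝ) = D at *
  rw [div_mul_eq_mul_div, mul_div_assoc', mul_div_assoc',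
    div_eq_div_iff (by positivity) (by positivity)]
  linear_combination (-(Real.Gamma ((α + d) / 2) * D * Real.Gamma ((α + 1) / 2) * r ^ α * α)) * hp

/-- Near the origin `f(0) - f(x)` of the Bessel potential is bounded below by a
positive multiple of `|x|^α`; in particular `f ∉ C^s(ℝ^d)` for every `s > α`. -/
theorem bessel_potential_not_holder
    (d : ℕ) (hd : 0 < d) (α : ℝ) (hα0 : 0 < α) (hα1 : α < 1) :
    (∀ x : Fin d → ℝ, 0 < Real.sqrt (∑ i, x i ^ 2) → Real.sqrt (∑ i, x i ^ 2) < 1 →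
      Real.Gamma ((α + 1) / 2) /
          (2 ^ (d - 1 : ℤ) * α * Real.pi ^ (((d : ℝ) + 1) / 2 + α) *
            Real.Gamma ((α + d) / 2)) *
          Real.sqrt (∑ i, x i ^ 2) ^ α
        ≤ besselPotential d α 0 - besselPotential d α x)
    ∧ ∀ s : ℝ, α < s →
      ¬ ∃ C : ℝ, ∀ x y : Fin d → ℝ,
        |besselPotential d α x - besselPotential d α y|
          ≤ C * Real.sqrt (∑ i, (x i - y i) ^ 2) ^ s := by
  refine ⟨fun x => le_besselPotential_zero_sub hα0 x, fun s hs ⟨C, hC⟩ => ?_⟩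
  set c := Real.Gamma ((α + 1) / 2) /
    (2 ^ (d - 1 : ℤ) * α * Real.pi ^ (((d : ℝ) + 1) / 2 + α) * Real.Gamma ((α + d) / 2)) with hc
  have hc0 : 0 < c := by
    have hG1 : 0 < Real.Gamma ((α + 1) / 2) := Real.Gamma_pos_of_pos (by positivity)
    have hGd : 0 < Real.Gamma ((α + d) / 2) := Real.Gamma_pos_of_pos (by positivity)
    positivity
  have hle : ∀ r : ℝ, 0 < r → r < 1 → c ≤ C * r ^ (s - α) := by
    intro r hr0 hr1
    let x : Fin d → ℝ := Pi.single ⟨0, hd⟩ r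
    have hx : Real.sqrt (∑ i, x i ^ 2) = r := by
      rw [Finset.sum_eq_single ⟨0, hd⟩ (fun i _ hi => by simp [x, hi]) (by simp)]
      simp [x, Real.sqrt_sq hr0.le]
    have h1 := le_besselPotential_zero_sub hα0 x (by rwa [hx]) (by rwa [hx])
    have h2 := (le_abs_self _).trans (hC 0 x)
    simp only [Pi.zero_apply, zero_sub, neg_sq] at h2
    rw [hx] at h1 h2
    have h3 : c * r ^ α ≤ C * r ^ (s - α) * r ^ α := by
      rw [mul_assoc, ← Real.rpow_add hr0, sub_add_cancel]
      exact h1.trans h2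
    exact le_of_mul_le_mul_right h3 (by positivity)
  have hlim : Filter.Tendsto (fun r : ℝ => C * r ^ (s - α)) (nhdsWithin 0 (Set.Ioi 0))
      (nhds 0) := by
    have h := (Real.continuousAt_rpow_const 0 (s - α) (Or.inr (by linarith))).tendsto
    rw [Real.zero_rpow (by linarith)] at h
    simpa using (h.mono_left nhdsWithin_le_nhds).const_mul C
  have hev : ∀ᶠ r : ℝ in nhdsWithin 0 (Set.Ioi 0), c ≤ C * r ^ (s - α) := by
    filter_upwards [Ioo_mem_nhdsGT (zero_lt_one' ℝ)] with r hr using hle r hr.1 hr.2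
  exact absurd (ge_of_tendsto hlim hev) (not_le.2 hc0)
end

section
/- Let d ∈ ℕ₊. Then for every x ∈ ℝ^d, ∫_{ℝ^d} (1 + 4π²|ξ|²)^{−(d+1)/2} e^{2πi ξ·x} dξ = 2^{−d} π^{(1−d)/2} Γ((d+1)/2)^{−1} e^{−|x|}, where |x| and |ξ| denote Euclidean norms and Γ is the Gamma function. -/
open MeasureTheory

open Filter Set Topology

/-- The primitive of the Gaussian `exp (-s²)` vanishing at `0`. -/
noncomputable def gaussianPrimitive (v : ℝ) : ℝ := ∫ s in (0 : ℝ)..v, Real.exp (-s ^ 2)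

lemma hasDerivAt_gaussianPrimitive (v : ℝ) :
    HasDerivAt gaussianPrimitive (Real.exp (-v ^ 2)) v := by
  have hc : Continuous fun s : ℝ => Real.exp (-s ^ 2) := by fun_prop
  exact hc.integral_hasStrictDerivAt 0 v |>.hasDerivAt

lemma tendsto_gaussianPrimitive_atTop :
    Tendsto gaussianPrimitive atTop (𝓝 (√Real.pi / 2)) := by
  have hint : Integrable fun s : ℝ => Real.exp (-s ^ 2) := by
    simpa using integrable_exp_neg_mul_sq one_pos
  have h := intervalIntegral_tendsto_integral_Ioi 0 hint.integrableOn tendsto_id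
  have h1 := integral_gaussian_Ioi 1
  simp only [neg_mul, one_mul, div_one] at h1
  rwa [h1] at h

lemma gaussianPrimitive_neg (v : ℝ) : gaussianPrimitive (-v) = -gaussianPrimitive v := by
  have h := intervalIntegral.integral_comp_neg (a := 0) (b := v) fun s : ℝ => Real.exp (-s ^ 2)
  simp only [neg_sq, neg_zero] at h
  rw [gaussianPrimitive, gaussianPrimitive, h, intervalIntegral.integral_symm]

lemma tendsto_gaussianPrimitive_atBot :
    Tendsto gaussianPrimitive atBot (𝓝 (-(√Real.pi / 2))) := by
  have h := (tendsto_gaussianPrimitive_atTop.comp tendsto_neg_atBot_atTop).neg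
  refine h.congr fun v => ?_
  simp [gaussianPrimitive_neg]

/-- The primitive on `(0, ∞)` of `t^(-1/2) exp (-t - r²/(4t))`. -/
noncomputable def schloemilchPrimitive (r t : ℝ) : ℝ :=
  Real.exp (-r) * gaussianPrimitive (√t - r / 2 * (√t)⁻¹) +
    Real.exp r * gaussianPrimitive (√t + r / 2 * (√t)⁻¹)

lemma hasDerivAt_schloemilchPrimitive (r : ℝ) {t : ℝ} (ht : 0 < t) :
    HasDerivAt (schloemilchPrimitive r)
      ((√t)⁻¹ * (Real.exp (-t) * Real.exp (-(r ^ 2 / (4 * t))))) t := by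
  have hs : 0 < √t := Real.sqrt_pos.2 ht
  have h1 := Real.hasDerivAt_sqrt ht.ne'
  have h2 := (h1.inv hs.ne').const_mul (r / 2)
  have hA := ((hasDerivAt_gaussianPrimitive _).comp t (h1.sub h2)).const_mul (Real.exp (-r))
  have hB := ((hasDerivAt_gaussianPrimitive _).comp t (h1.add h2)).const_mul (Real.exp r)
  refine (hA.add hB).congr_deriv ?_
  have hexp (ε : ℝ) (hε : ε ^ 2 = 1) :
      Real.exp (-(√t + ε * (r / 2 * (√t)⁻¹)) ^ 2) =
        Real.exp (-(ε * r)) * (Real.exp (-t) * Real.exp (-(r ^ 2 / (4 * t)))) := by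
    rw [← Real.exp_add, ← Real.exp_add]
    congr 1
    have hsq : √t ^ 2 = t := Real.sq_sqrt ht.le
    rw [← hsq]
    field_simp
    rw [Real.sqrt_sq hs.le]
    linear_combination (-4 * √t ^ 2 * r ^ 2) * hε
  have hm := hexp (-1) (by norm_num)
  have hp := hexp 1 (by norm_num)
  simp only [neg_mul, one_mul, neg_neg, ← sub_eq_add_neg] at hm hp
  simp only [Pi.sub_apply, Pi.add_apply, Pi.inv_apply]
  rw [hm, hp]
  have he : Real.exp (-r) * Real.exp r = 1 := by rw [← Real.exp_add]; simp
  linear_combination ((√t)⁻¹ * (Real.exp (-t) * Real.exp (-(r ^ 2 / (4 * t))))) * he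

lemma tendsto_schloemilchPrimitive_atTop (r : ℝ) :
    Tendsto (schloemilchPrimitive r) atTop
      (𝓝 (Real.exp (-r) * (√Real.pi / 2) + Real.exp r * (√Real.pi / 2))) := by
  have hs := Real.tendsto_sqrt_atTop
  have hi := (tendsto_inv_atTop_zero.comp hs).const_mul (r / 2)
  refine ((tendsto_gaussianPrimitive_atTop.comp ?_).const_mul _).add
    ((tendsto_gaussianPrimitive_atTop.comp ?_).const_mul _)
  · simpa only [sub_eq_add_neg, Function.comp_apply] using hs.atTop_add hi.neg
  · exact hs.atTop_add hi

lemma tendsto_schloemilchPrimitive_zero {r : ℝ} (hr : 0 < r) :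
    Tendsto (schloemilchPrimitive r) (𝓝[>] 0)
      (𝓝 (Real.exp (-r) * -(√Real.pi / 2) + Real.exp r * (√Real.pi / 2))) := by
  have hs : Tendsto Real.sqrt (𝓝[>] 0) (𝓝 0) := by
    simpa using (Real.continuous_sqrt.tendsto 0).mono_left nhdsWithin_le_nhds
  have hs' : Tendsto Real.sqrt (𝓝[>] 0) (𝓝[>] 0) :=
    tendsto_nhdsWithin_iff.2 ⟨hs, by
      filter_upwards [self_mem_nhdsWithin] with t ht using Real.sqrt_pos.2 ht⟩
  have hi := (tendsto_inv_nhdsGT_zero.comp hs').const_mul_atTop (half_pos hr)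
  refine ((tendsto_gaussianPrimitive_atBot.comp ?_).const_mul _).add
    ((tendsto_gaussianPrimitive_atTop.comp ?_).const_mul _)
  · simpa only [sub_eq_add_neg, Function.comp_def] using hs.add_atBot (tendsto_neg_atTop_atBot.comp hi)
  · exact hs.add_atTop hi

lemma integral_inv_sqrt_mul_exp {r : ℝ} (hr : 0 ≤ r) :
    ∫ t in Ioi (0 : ℝ), (√t)⁻¹ * (Real.exp (-t) * Real.exp (-(r ^ 2 / (4 * t)))) =
      √Real.pi * Real.exp (-r) := by
  rcases hr.eq_or_lt with rfl | hr
  · have h := Real.Gamma_eq_integral (s := 1 / 2) (by norm_num)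
    rw [Real.Gamma_one_half_eq] at h
    simp only [neg_zero, Real.exp_zero, mul_one, h]
    refine setIntegral_congr_fun measurableSet_Ioi fun t (ht : 0 < t) => ?_
    simp only [Real.sqrt_eq_rpow, ← Real.rpow_neg ht.le]
    norm_num [mul_comm]
  · set L := Real.exp (-r) * -(√Real.pi / 2) + Real.exp r * (√Real.pi / 2)
    have heq : EqOn (Function.update (schloemilchPrimitive r) 0 L) (schloemilchPrimitive r)
        (Ioi 0) := fun t ht => Function.update_of_ne (ne_of_gt ht) _ _
    have h := integral_Ioi_of_hasDerivAt_of_nonneg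
      (g := Function.update (schloemilchPrimitive r) 0 L)
      (g' := fun t => (√t)⁻¹ * (Real.exp (-t) * Real.exp (-(r ^ 2 / (4 * t)))))
      (a := 0) (l := Real.exp (-r) * (√Real.pi / 2) + Real.exp r * (√Real.pi / 2)) ?_ ?_ ?_ ?_
    · rw [h, Function.update_self]
      ring
    · rw [← continuousWithinAt_Ioi_iff_Ici, ContinuousWithinAt, Function.update_self]
      exact (tendsto_schloemilchPrimitive_zero hr).congr'
        (heq.symm.eventuallyEq_of_mem self_mem_nhdsWithin)
    · intro t ht
      exact (hasDerivAt_schloemilchPrimitive r ht).congr_of_eventuallyEq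
        (heq.eventuallyEq_of_mem (Ioi_mem_nhds ht))
    · intro t _
      positivity
    · exact (tendsto_schloemilchPrimitive_atTop r).congr'
        (heq.symm.eventuallyEq_of_mem (Ioi_mem_atTop 0))

variable {d : ℕ}

lemma gaussian_mul_character_eq (t : ℝ) (x ξ : Fin d → ℝ) :
    ((Real.exp (-(4 * Real.pi ^ 2 * t * ∑ i, ξ i ^ 2)) : ℝ) : ℂ) *
        Complex.exp (2 * (Real.pi : ℂ) * Complex.I * (dot ξ x : ℝ)) =
      Complex.exp (-((4 * Real.pi ^ 2 * t : ℝ) : ℂ) * ∑ i, (ξ i : ℂ) ^ 2 +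
        ∑ i, (2 * (Real.pi : ℂ) * Complex.I * x i) * ξ i) := by
  rw [Complex.exp_add, dot, Complex.ofReal_exp]
  push_cast
  rw [Finset.mul_sum Finset.univ (fun i => (ξ i : ℂ) * x i)]
  congr 2
  · ring
  · exact Finset.sum_congr rfl fun i _ => by ring

lemma integrable_gaussian_mul_character {t : ℝ} (ht : 0 < t) (x : Fin d → ℝ) :
    Integrable fun ξ : Fin d → ℝ =>
      ((Real.exp (-(4 * Real.pi ^ 2 * t * ∑ i, ξ i ^ 2)) : ℝ) : ℂ) *
        Complex.exp (2 * (Real.pi : ℂ) * Complex.I * (dot ξ x : ℝ)) := by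
  simp only [gaussian_mul_character_eq]
  refine GaussianFourier.integrable_cexp_neg_mul_sum_add ?_ _
  rw [Complex.ofReal_re]
  positivity

lemma integral_gaussian_mul_character {t : ℝ} (ht : 0 < t) (x : Fin d → ℝ) :
    ∫ ξ : Fin d → ℝ, ((Real.exp (-(4 * Real.pi ^ 2 * t * ∑ i, ξ i ^ 2)) : ℝ) : ℂ) *
        Complex.exp (2 * (Real.pi : ℂ) * Complex.I * (dot ξ x : ℝ)) =
      (((4 * Real.pi * t) ^ (-(d : ℝ) / 2) *
        Real.exp (-((∑ i, x i ^ 2) / (4 * t))) : ℝ) : ℂ) := by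
  simp only [gaussian_mul_character_eq]
  rw [GaussianFourier.integral_cexp_neg_mul_sum_add
    (by rw [Complex.ofReal_re]; positivity), Fintype.card_fin]
  have hπ := Real.pi_pos
  have h1 : Real.pi / (4 * Real.pi ^ 2 * t) = (4 * Real.pi * t)⁻¹ := by
    field_simp
  have h2 : ((Real.pi : ℂ) / ((4 * Real.pi ^ 2 * t : ℝ) : ℂ)) ^ ((d : ℂ) / 2) =
      (((4 * Real.pi * t) ^ (-(d : ℝ) / 2) : ℝ) : ℂ) := by
    rw [← Complex.ofReal_div, h1, neg_div, Real.rpow_neg (by positivity),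
      ← Real.inv_rpow (by positivity), Complex.ofReal_cpow (by positivity)]
    push_cast
    rfl
  rw [h2, Complex.ofReal_mul ((4 * Real.pi * t) ^ (-(d : ℝ) / 2)), Complex.ofReal_exp]
  congr 2
  have hπ' : (Real.pi : ℂ) ≠ 0 := by exact_mod_cast hπ.ne'
  have ht' : (t : ℂ) ≠ 0 := by exact_mod_cast ht.ne'
  simp only [mul_pow, Complex.I_sq, ← Finset.mul_sum]
  push_cast
  field_simp
  ring

lemma integral_gaussian_norm {t : ℝ} (ht : 0 < t) :
    ∫ ξ : Fin d → ℝ, Real.exp (-(4 * Real.pi ^ 2 * t * ∑ i, ξ i ^ 2)) =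
      (4 * Real.pi * t) ^ (-(d : ℝ) / 2) := by
  have h := integral_gaussian_mul_character ht (0 : Fin d → ℝ)
  simp only [dot, Pi.zero_apply, mul_zero, Finset.sum_const_zero, Complex.ofReal_zero,
    Complex.exp_zero, mul_one, ne_eq, OfNat.ofNat_ne_zero, not_false_eq_true, zero_pow,
    zero_div, neg_zero, Real.exp_zero] at h
  rw [integral_complex_ofReal] at h
  exact_mod_cast h

lemma rpow_mul_rpow_neg_half {t : ℝ} (ht : 0 < t) :
    t ^ (((d : ℝ) + 1) / 2 - 1) * (4 * Real.pi * t) ^ (-(d : ℝ) / 2) =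
      (4 * Real.pi) ^ (-(d : ℝ) / 2) * (√t)⁻¹ := by
  rw [Real.mul_rpow (by positivity) ht.le, Real.sqrt_eq_rpow, ← Real.rpow_neg ht.le,
    mul_left_comm, ← Real.rpow_add ht]
  congr 2
  ring

/-- The integrand obtained by writing `(1 + 4π²|ξ|²)^(-(d+1)/2)` as a Gamma integral. -/
noncomputable def subordinatedKernel (x ξ : Fin d → ℝ) (t : ℝ) : ℂ :=
  ((t ^ (((d : ℝ) + 1) / 2 - 1) * Real.exp (-t) : ℝ) : ℂ) *
    (((Real.exp (-(4 * Real.pi ^ 2 * t * ∑ i, ξ i ^ 2)) : ℝ) : ℂ) *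
      Complex.exp (2 * (Real.pi : ℂ) * Complex.I * (dot ξ x : ℝ)))

lemma norm_subordinatedKernel (x ξ : Fin d → ℝ) {t : ℝ} (ht : 0 < t) :
    ‖subordinatedKernel x ξ t‖ = t ^ (((d : ℝ) + 1) / 2 - 1) * Real.exp (-t) *
      Real.exp (-(4 * Real.pi ^ 2 * t * ∑ i, ξ i ^ 2)) := by
  have hchar : ‖Complex.exp (2 * (Real.pi : ℂ) * Complex.I * (dot ξ x : ℝ))‖ = 1 := by
    rw [Complex.norm_exp]
    simp
  rw [subordinatedKernel, norm_mul, norm_mul, hchar, mul_one, Complex.norm_real,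
    Complex.norm_real, Real.norm_of_nonneg (by positivity), Real.norm_of_nonneg (by positivity)]

lemma measurable_uncurry_subordinatedKernel (x : Fin d → ℝ) :
    Measurable (Function.uncurry (subordinatedKernel x)) := by
  unfold Function.uncurry subordinatedKernel dot
  fun_prop

lemma integrable_uncurry_subordinatedKernel (x : Fin d → ℝ) :
    Integrable (Function.uncurry (subordinatedKernel x))
      ((volume : Measure (Fin d → ℝ)).prod (volume.restrict (Ioi (0 : ℝ)))) := by
  refine (integrable_prod_iff' (measurable_uncurry_subordinatedKernel x).aestronglyMeasurable).2
    ⟨?_, ?_⟩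
  · filter_upwards [ae_restrict_mem measurableSet_Ioi] with t ht
    simpa only [Function.uncurry_apply_pair, subordinatedKernel] using
      (integrable_gaussian_mul_character ht x).const_mul _
  · have h : IntegrableOn (fun t : ℝ => (4 * Real.pi) ^ (-(d : ℝ) / 2) *
        (Real.exp (-t) * t ^ ((1 / 2 : ℝ) - 1))) (Ioi 0) :=
      (Real.GammaIntegral_convergent (by norm_num)).const_mul _
    refine h.congr ?_
    filter_upwards [ae_restrict_mem measurableSet_Ioi] with t ht
    have ht : 0 < t := ht
    simp only [Function.uncurry_apply_pair, norm_subordinatedKernel x _ ht]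
    rw [integral_const_mul, integral_gaussian_norm ht, mul_right_comm,
      rpow_mul_rpow_neg_half ht, Real.sqrt_eq_rpow, ← Real.rpow_neg ht.le]
    norm_num
    ring

lemma integral_subordinatedKernel_right (x ξ : Fin d → ℝ) :
    ∫ t in Ioi (0 : ℝ), subordinatedKernel x ξ t =
      (Real.Gamma (((d : ℝ) + 1) / 2) : ℂ) *
        ((((1 + 4 * Real.pi ^ 2 * (∑ i, ξ i ^ 2)) ^ (-((d : ℝ) + 1) / 2) : ℝ) : ℂ) *
          Complex.exp (2 * (Real.pi : ℂ) * Complex.I * (dot ξ x : ℝ))) := by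
  have hA : 0 < 1 + 4 * Real.pi ^ 2 * ∑ i, ξ i ^ 2 := by positivity
  have h := Real.integral_rpow_mul_exp_neg_mul_Ioi
    (a := ((d : ℝ) + 1) / 2) (by positivity) hA
  rw [one_div, Real.inv_rpow hA.le, ← Real.rpow_neg hA.le, ← neg_div] at h
  rw [← mul_assoc, ← Complex.ofReal_mul, mul_comm (Real.Gamma _), ← h,
    ← integral_complex_ofReal, ← integral_mul_const]
  refine integral_congr_ae (Eventually.of_forall fun t => ?_)
  simp only [subordinatedKernel]
  rw [← mul_assoc, ← Complex.ofReal_mul, mul_assoc (t ^ _), ← Real.exp_add]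
  ring_nf

lemma integral_subordinatedKernel_left (x : Fin d → ℝ) {t : ℝ} (ht : 0 < t) :
    ∫ ξ, subordinatedKernel x ξ t =
      (((4 * Real.pi) ^ (-(d : ℝ) / 2) * ((√t)⁻¹ *
        (Real.exp (-t) * Real.exp (-(√(∑ i, x i ^ 2) ^ 2 / (4 * t))))) : ℝ) : ℂ) := by
  simp only [subordinatedKernel]
  rw [integral_const_mul, integral_gaussian_mul_character ht, ← Complex.ofReal_mul,
    Real.sq_sqrt (by positivity), ← mul_assoc _ (√t)⁻¹, ← rpow_mul_rpow_neg_half ht]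
  congr 1
  ring

lemma four_mul_pi_rpow_mul_sqrt_pi (d : ℕ) :
    (4 * Real.pi) ^ (-(d : ℝ) / 2) * √Real.pi =
      (2 : ℝ) ^ (-(d : ℤ)) * Real.pi ^ ((1 - (d : ℝ)) / 2) := by
  have hπ := Real.pi_pos
  rw [Real.mul_rpow (by norm_num) hπ.le, Real.sqrt_eq_rpow, mul_assoc, ← Real.rpow_add hπ,
    show (4 : ℝ) = 2 ^ (2 : ℝ) by norm_num, ← Real.rpow_mul (by norm_num), ← Real.rpow_intCast]
  push_cast
  ring_nf

/-- Explicit formula for the Bessel potential of order `1 + d`: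
`∫_{ℝ^d} (1+4π²|ξ|²)^{-(d+1)/2} e^{2πi ξ·x} dξ
  = 2^{-d} π^{(1-d)/2} Γ((d+1)/2)⁻¹ e^{-|x|}`. -/
theorem bessel_potential_order_one_explicit
    (d : ℕ) (hd : 0 < d) (x : Fin d → ℝ) :
    (∫ ξ : Fin d → ℝ,
        (((1 + 4 * Real.pi ^ 2 * (∑ i, ξ i ^ 2)) ^ (-((d : ℝ) + 1) / 2) : ℝ) : ℂ) *
          Complex.exp (2 * (Real.pi : ℂ) * Complex.I * (dot ξ x : ℝ)))
      = (((2 : ℝ) ^ (-(d : ℤ)) * Real.pi ^ ((1 - (d : ℝ)) / 2) *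
          (Real.Gamma (((d : ℝ) + 1) / 2))⁻¹ *
          Real.exp (-Real.sqrt (∑ i, x i ^ 2)) : ℝ) : ℂ) := by
  have hΓ : Real.Gamma (((d : ℝ) + 1) / 2) ≠ 0 := (Real.Gamma_pos_of_pos (by positivity)).ne'
  refine mul_left_cancel₀ (Complex.ofReal_ne_zero.2 hΓ) ?_
  rw [← integral_const_mul]
  simp only [← integral_subordinatedKernel_right]
  rw [integral_integral_swap (integrable_uncurry_subordinatedKernel x),
    setIntegral_congr_fun measurableSet_Ioi fun t ht => integral_subordinatedKernel_left x ht,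
    integral_complex_ofReal, integral_const_mul, integral_inv_sqrt_mul_exp (Real.sqrt_nonneg _),
    ← mul_assoc, four_mul_pi_rpow_mul_sqrt_pi, ← Complex.ofReal_mul]
  congr 1
  field_simp
end
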